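/- arXiv:2004.04610 — 7 statements merged into one kernel-verified Lean document; each statement's English description precedes it below -/
import Mathlib

section
/- Let p be a prime and let G be a finite p-group with a regular power structure, and let H_p(G) be the subgroup of G generated by the elements of G whose order is not equal to p. If the exponent of G equals p, then H_p(G) is the trivial subgroup; if the exponent of G is strictly greater than p, then H_p(G) = G. -/
/-- The subgroup `G^n` of `G` generated by the `n`-th powers of elements of `G`. -/
def powerSubgroup (G : Type*) [Group G] (n : ℕ) : Subgroup G :=
  Subgroup.closure {x : G | ∃ g : G, g ^ n = x}

/-- The subgroup `Ω_i(G)` of `G` generated by the elements `g` with `g ^ p ^ i = 1`. -/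
def omegaSubgroup (G : Type*) [Group G] (p i : ℕ) : Subgroup G :=
  Subgroup.closure {g : G | g ^ p ^ i = 1}

/-- `G^n` is a (characteristic, hence) normal subgroup of `G`. -/
instance powerSubgroup_normal (G : Type*) [Group G] (n : ℕ) :
    (powerSubgroup G n).Normal := by
  constructor
  intro a ha g
  have key : ∀ a ∈ powerSubgroup G n, ∀ g : G, g * a * g⁻¹ ∈ powerSubgroup G n := by
    intro a ha
    refine Subgroup.closure_induction (fun x hx g => ?_) (fun g => by simpa using
        (powerSubgroup G n).one_mem) (fun x y _ _ hx hy g => ?_) (fun x _ hx g => ?_) ha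
    · obtain ⟨h, rfl⟩ := hx
      exact Subgroup.subset_closure ⟨g * h * g⁻¹, by rw [conj_pow]⟩
    · have := (powerSubgroup G n).mul_mem (hx g) (hy g)
      simpa [mul_assoc] using this
    · have := (powerSubgroup G n).inv_mem (hx g)
      simpa [mul_assoc] using this
  exact key a ha g

/-- A finite `p`-group `G` has a *regular power structure* if for every `i ≥ 1`:
(1) every element of `G^{p^i}` is a genuine `p^i`-th power;
(2) every element of `Ω_i(G)` has order dividing `p^i`;
(3) `[G : G^{p^i}] = |Ω_i(G)|`. -/
def RegularPowerStructure (p : ℕ) (G : Type*) [Group G] : Prop :=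
  ∀ i : ℕ, 1 ≤ i →
    (∀ x ∈ powerSubgroup G (p ^ i), ∃ g : G, g ^ p ^ i = x) ∧
    (∀ x ∈ omegaSubgroup G p i, x ^ p ^ i = 1) ∧
    (powerSubgroup G (p ^ i)).index = Nat.card (omegaSubgroup G p i)

/-- The Hughes subgroup `H_p(G)`: the subgroup generated by the elements of `G`
whose order is not `p`. -/
def hughesSubgroup (p : ℕ) (G : Type*) [Group G] : Subgroup G :=
  Subgroup.closure {g : G | orderOf g ≠ p}

/-- **Hughes conjecture for groups with regular power structure.**
If `G` is a finite `p`-group with regular power structure, then `H_p(G) = 1` when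
`G` has exponent `p`, and `H_p(G) = G` when the exponent of `G` is greater than `p`. -/
theorem hughes_for_regular_power_structure
    (p : ℕ) (hp : p.Prime) (G : Type) [Group G] [Finite G] (hG : IsPGroup p G)
    (hreg : RegularPowerStructure p G) :
    (Monoid.exponent G = p → hughesSubgroup p G = ⊥) ∧
      (p < Monoid.exponent G → hughesSubgroup p G = ⊤) := by
  refine ⟨fun hexp => ?_, fun hlt => ?_⟩
  · refine (Subgroup.closure_eq_bot_iff).2 fun g hg => ?_
    rcases (Nat.dvd_prime hp).1 (hexp ▸ Monoid.order_dvd_exponent g) with h | h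
    · exact orderOf_eq_one_iff.1 h
    · exact absurd h hg
  · have pow_eq_one : ∀ x ∈ omegaSubgroup G p 1, x ^ p = 1 := by
      simpa using (hreg 1 le_rfl).2.1
    obtain ⟨a, ha⟩ : ∃ a : G, a ^ p ≠ 1 := by
      by_contra! h
      exact hlt.not_ge (Nat.le_of_dvd hp.pos (Monoid.exponent_dvd_of_forall_pow_eq_one h))
    have mem_hughes : ∀ x ∉ omegaSubgroup G p 1, x ∈ hughesSubgroup p G := by
      refine fun x hx => Subgroup.subset_closure fun h => hx (Subgroup.subset_closure ?_)
      simpa [h] using pow_orderOf_eq_one x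
    have ha' : a ∉ omegaSubgroup G p 1 := fun h => ha (pow_eq_one a h)
    refine (Subgroup.eq_top_iff' _).2 fun x => ?_
    by_cases hx : x ∈ omegaSubgroup G p 1
    · have hxa := mem_hughes (x * a) fun h => ha' ((Subgroup.mul_mem_cancel_left _ hx).1 h)
      exact (Subgroup.mul_mem_cancel_right _ (mem_hughes a ha')).1 hxa
    · exact mem_hughes x hx
end

section
/- Let p be a prime and let G be a nontrivial finite p-group with a regular power structure, and let H_p(G) be the subgroup of G generated by the elements of G whose order is not equal to p. Then the index [G : H_p(G)] equals p if and only if G has order p (i.e. G is cyclic of order p). -/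
/-- The elements of order different from `p` are trivial in a group of exponent `p`, so the
Hughes subgroup is trivial. -/
theorem hughesSubgroup_eq_bot_of_pow_eq_one {p : ℕ} (hp : p.Prime) {G : Type*} [Group G]
    (h : ∀ x : G, x ^ p = 1) : hughesSubgroup p G = ⊥ := by
  refine (Subgroup.closure_eq_bot_iff).2 fun x hx => ?_
  rcases (Nat.dvd_prime hp).1 (orderOf_dvd_of_pow_eq_one (h x)) with h1 | h1
  · exact orderOf_eq_one_iff.1 h1
  · exact absurd h1 hx

/-- Elements outside the Hughes subgroup have order `p`, and the complement of a proper subgroup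
generates the group. -/
theorem omegaSubgroup_one_eq_top_of_hughesSubgroup_ne_top {p : ℕ} {G : Type*} [Group G]
    (h : hughesSubgroup p G ≠ ⊤) : omegaSubgroup G p 1 = ⊤ := by
  have key : ∀ x ∉ hughesSubgroup p G, x ∈ omegaSubgroup G p 1 := by
    intro x hx
    have hord : orderOf x = p := by
      by_contra hne
      exact hx (Subgroup.subset_closure hne)
    refine Subgroup.subset_closure ?_
    rw [Set.mem_ofPred_eq, pow_one, ← hord, pow_orderOf_eq_one]
  obtain ⟨g, hg⟩ : ∃ g, g ∉ hughesSubgroup p G := by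
    by_contra! hall
    exact h ((Subgroup.eq_top_iff' _).2 hall)
  refine (Subgroup.eq_top_iff' _).2 fun x => ?_
  by_cases hx : x ∈ hughesSubgroup p G
  · exact (Subgroup.mul_mem_cancel_right _ (key g hg)).1
      (key (x * g) fun hxg => hg ((Subgroup.mul_mem_cancel_left _ hx).1 hxg))
  · exact key x hx

/-- For a nontrivial finite `p`-group `G` with regular power structure, the Hughes
subgroup has index `p` in `G` if and only if `G` is cyclic of order `p`. -/
theorem hughes_index_eq_p_iff
    (p : ℕ) (hp : p.Prime) (G : Type) [Group G] [Finite G] [Nontrivial G]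
    (hG : IsPGroup p G) (hreg : RegularPowerStructure p G) :
    (hughesSubgroup p G).index = p ↔ Nat.card G = p := by
  constructor
  · intro hidx
    have hne : hughesSubgroup p G ≠ ⊤ := by
      intro htop
      rw [htop, Subgroup.index_top] at hidx
      exact hp.ne_one hidx.symm
    have hexp : ∀ x : G, x ^ p = 1 := fun x => by
      have hx := (hreg 1 le_rfl).2.1 x
      rw [omegaSubgroup_one_eq_top_of_hughesSubgroup_ne_top hne, pow_one] at hx
      exact hx (Subgroup.mem_top x)
    rwa [hughesSubgroup_eq_bot_of_pow_eq_one hp hexp, Subgroup.index_bot] at hidx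
  · intro hcard
    have hexp : ∀ x : G, x ^ p = 1 := fun x => hcard ▸ pow_card_eq_one'
    rwa [hughesSubgroup_eq_bot_of_pow_eq_one hp hexp, Subgroup.index_bot]
end

section
/- Let p be an odd prime and let G be a finite p-group such that every normal abelian subgroup of G is cyclic. Then G is cyclic. -/
/-- The power of a product of two elements whose commutator `c` is central in the subgroup
they generate. -/
theorem mul_pow_of_mul_eq_mul_mul {G : Type*} [Group G] {b y c : G} (hc : y * b = b * y * c)
    (hcb : Commute c b) (hcy : Commute c y) (n : ℕ) :
    (b * y) ^ n = b ^ n * y ^ n * c ^ n.choose 2 := by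
  have key : ∀ n : ℕ, y ^ n * b = b * y ^ n * c ^ n := by
    intro n
    induction n with
    | zero => simp
    | succ n ih =>
      calc y ^ (n + 1) * b = y * (y ^ n * b) := by rw [pow_succ', mul_assoc]
        _ = (y * b) * y ^ n * c ^ n := by rw [ih]; group
        _ = b * y * (c * y ^ n) * c ^ n := by rw [hc]; group
        _ = b * y * (y ^ n * c) * c ^ n := by rw [(hcy.pow_right n).eq]
        _ = b * y ^ (n + 1) * c ^ (n + 1) := by rw [pow_succ' y, pow_succ' c]; group
  induction n with
  | zero => simp
  | succ n ih =>
    have h1 : Commute (c ^ n.choose 2) (b * y) := (hcb.mul_right hcy).pow_left _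
    have h2 : Commute (c ^ n) y := hcy.pow_left n
    calc (b * y) ^ (n + 1) = b ^ n * y ^ n * (c ^ n.choose 2 * (b * y)) := by
          rw [pow_succ, ih, mul_assoc]
      _ = b ^ n * (y ^ n * b) * y * c ^ n.choose 2 := by rw [h1.eq]; group
      _ = b ^ n * b * y ^ n * (c ^ n * y) * c ^ n.choose 2 := by rw [key]; group
      _ = b ^ (n + 1) * y ^ (n + 1) * (c ^ n * c ^ n.choose 2) := by
          rw [h2.eq, pow_succ, pow_succ]; group
      _ = b ^ (n + 1) * y ^ (n + 1) * c ^ (n + 1).choose 2 := by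
          rw [← pow_add, Nat.choose_succ_succ' n 1, Nat.choose_one_right]

/-- Adjoining to an abelian normal subgroup `S` an element that centralizes `S` and is central
modulo `S` yields an abelian normal subgroup. -/
theorem Subgroup.exists_normal_commute_of_central_mod {G : Type*} [Group G] (S : Subgroup G)
    (hS : S.Normal) (hcomm : ∀ a ∈ S, ∀ b ∈ S, a * b = b * a) (y : G)
    (hy : ∀ a ∈ S, a * y = y * a) (hcen : ∀ g : G, g * y * g⁻¹ * y⁻¹ ∈ S) :
    ∃ N : Subgroup G, N.Normal ∧ (∀ a ∈ N, ∀ b ∈ N, a * b = b * a) ∧ S ≤ N ∧ y ∈ N := by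
  refine ⟨closure (insert y (S : Set G)), ?_, ?_, ?_, ?_⟩
  · refine ⟨fun n hn g => ?_⟩
    suffices h : closure (insert y (S : Set G)) ≤
        (closure (insert y (S : Set G))).comap (MulAut.conj g).toMonoidHom by
      simpa using h hn
    rw [closure_le]
    intro z hz
    have hSle : ∀ s ∈ S, s ∈ closure (insert y (S : Set G)) := fun s hs =>
      subset_closure (Set.mem_insert_of_mem _ hs)
    have hymem : y ∈ closure (insert y (S : Set G)) := subset_closure (Set.mem_insert _ _)
    rcases hz with rfl | hz
    · have := mul_mem (hSle _ (hcen g)) hymem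
      simpa using this
    · simpa using hSle _ (hS.conj_mem z hz g)
  · have hset : ∀ a ∈ insert y (S : Set G), ∀ b ∈ insert y (S : Set G), a * b = b * a := by
      rintro a (rfl | ha) b (rfl | hb)
      · rfl
      · exact (hy b hb).symm
      · exact hy a ha
      · exact hcomm a ha b hb
    intro a ha b hb
    have h1 : closure (insert y (S : Set G)) ≤ centralizer (insert y (S : Set G)) := by
      rw [closure_le]
      intro z hz
      exact mem_centralizer_iff.2 fun w hw => hset w hw z hz
    have h2 : closure (insert y (S : Set G)) ≤
        centralizer (closure (insert y (S : Set G)) : Set G) := by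
      rw [closure_le]
      intro z hz
      refine mem_centralizer_iff.2 fun w hw => ?_
      exact (mem_centralizer_iff.1 (h1 hw) z hz).symm
    exact (mem_centralizer_iff.1 (h2 hb) a ha)
  · exact fun s hs => subset_closure (Set.mem_insert_of_mem _ hs)
  · exact subset_closure (Set.mem_insert _ _)

/-- An integer that is a `p`-th root of unity modulo `p ^ n` is congruent to `1` modulo `p`, and
modulo `p ^ (n - 1)`. -/
theorem Int.dvd_sub_one_of_dvd_pow_sub_one {p n : ℕ} (hp : p.Prime) (hodd : Odd p) (hn : n ≠ 0)
    {k : ℤ} (hk : (p : ℤ) ^ n ∣ k ^ p - 1) :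
    (p : ℤ) ∣ k - 1 ∧ (p : ℤ) ^ n ∣ p * (k - 1) := by
  have := Fact.mk hp
  have h1 : (p : ℤ) ∣ k - 1 := by
    have h2 : (p : ℤ) ∣ k ^ p - 1 := (dvd_pow_self _ hn).trans hk
    rw [← ZMod.intCast_zmod_eq_zero_iff_dvd] at h2 ⊢
    push_cast at h2 ⊢
    rwa [ZMod.pow_card] at h2
  have hpk : ¬ (p : ℤ) ∣ k := fun h => by
    have h3 : (p : ℤ) ∣ 1 := by simpa using dvd_sub h h1
    exact hp.one_lt.ne' (by exact_mod_cast Int.eq_one_of_dvd_one (by positivity) h3)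
  refine ⟨h1, ?_⟩
  have h4 := Int.emultiplicity_pow_sub_pow hp hodd (x := k) (y := 1) (by simpa using h1) hpk p
  rw [one_pow] at h4
  rw [pow_dvd_iff_le_emultiplicity] at hk ⊢
  rw [emultiplicity_mul (Nat.prime_iff_prime_int.1 hp), add_comm, Int.natCast_emultiplicity]
  rwa [h4] at hk

/-- In a cyclic group, all elements killed by the prime `p` lie in the subgroup generated by any
nontrivial one of them. -/
theorem IsCyclic.mem_zpowers_of_pow_prime_eq_one {G : Type*} [Group G] [Finite G] [IsCyclic G]
    {p : ℕ} (hp : p.Prime) {c y : G} (hc : c ^ p = 1) (hc1 : c ≠ 1) (hy : y ^ p = 1) :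
    y ∈ Subgroup.zpowers c := by
  classical
  let _ := Fintype.ofFinite G
  have hle := IsCyclic.card_pow_eq_one_le (α := G) hp.pos
  have hord : Fintype.card (Subgroup.zpowers c) = p := by
    rw [Fintype.card_zpowers]
    have := Fact.mk hp
    exact orderOf_eq_prime hc hc1
  have hsub : (Finset.univ.filter (· ∈ Subgroup.zpowers c)) ⊆
      (Finset.univ.filter fun a : G => a ^ p = 1) := by
    intro z hz
    simp only [Finset.mem_filter, Finset.mem_univ, true_and] at hz ⊢
    obtain ⟨j, rfl⟩ := hz
    change (c ^ j) ^ p = 1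
    rw [← zpow_natCast, zpow_comm, zpow_natCast, hc, one_zpow]
  have heq := Finset.eq_of_subset_of_card_le hsub (by
    refine hle.trans_eq ?_
    rw [← hord, Fintype.card_subtype])
  have : y ∈ Finset.univ.filter (· ∈ Subgroup.zpowers c) := by
    rw [heq]; simpa using hy
  simpa using this

/-- A nontrivial finite `p`-quotient `G ⧸ A` contains a central subgroup of order `p`. -/
theorem IsPGroup.exists_central_mod {p : ℕ} (hp : p.Prime) {G : Type*} [Group G] [Finite G]
    (hG : IsPGroup p G) (A : Subgroup G) (hA : A.Normal) (hne : A ≠ ⊤) :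
    ∃ x ∉ A, x ^ p ∈ A ∧ ∀ g : G, g * x * g⁻¹ * x⁻¹ ∈ A := by
  have := Fact.mk hp
  have : Nontrivial (G ⧸ A) := QuotientGroup.nontrivial_iff.2 hne
  have hQ := hG.to_quotient A
  have := hQ.center_nontrivial
  have hdvd : p ∣ Nat.card (Subgroup.center (G ⧸ A)) :=
    (hQ.to_subgroup _).card_eq_or_dvd.resolve_left Finite.one_lt_card.ne'
  obtain ⟨⟨q, hq⟩, hqo⟩ := exists_prime_orderOf_dvd_card' p hdvd
  obtain ⟨x, rfl⟩ := QuotientGroup.mk_surjective q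
  rw [Subgroup.orderOf_mk] at hqo
  refine ⟨x, fun hx => ?_, ?_, fun g => ?_⟩
  · rw [(QuotientGroup.eq_one_iff x).2 hx, orderOf_one] at hqo
    exact hp.one_lt.ne hqo
  · rw [← QuotientGroup.eq_one_iff, QuotientGroup.mk_pow, ← hqo, pow_orderOf_eq_one]
  · rw [← QuotientGroup.eq_one_iff]
    have := Subgroup.mem_center_iff.1 hq (g : G ⧸ A)
    simp only [QuotientGroup.mk_mul, QuotientGroup.mk_inv]
    rw [this]
    group

/-- If `p` is an odd prime and `G` is a finite `p`-group in which every normal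
abelian subgroup is cyclic, then `G` is cyclic. -/
theorem cyclic_of_normal_abelian_subgroups_cyclic
    (p : ℕ) (hp : p.Prime) (hodd : Odd p) (G : Type) [Group G] [Finite G]
    (hG : IsPGroup p G)
    (h : ∀ H : Subgroup G, H.Normal → (∀ a b : H, a * b = b * a) → IsCyclic H) :
    IsCyclic G := by
  have h' : ∀ H : Subgroup G, H.Normal → (∀ a ∈ H, ∀ b ∈ H, a * b = b * a) → IsCyclic H :=
    fun H hH hc => h H hH fun a b => Subtype.ext (hc a a.2 b b.2)
  obtain ⟨A, ⟨hAn, hAc⟩, hmax⟩ := (Set.toFinite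
    {H : Subgroup G | H.Normal ∧ ∀ a ∈ H, ∀ b ∈ H, a * b = b * a}).exists_maximal
    ⟨⊥, inferInstance, by simp⟩
  have hAcyc := h' A hAn hAc
  by_cases hne : A = ⊤
  · subst hne
    exact isCyclic_of_surjective (Subgroup.topEquiv (G := G)) (Subgroup.topEquiv).surjective
  exfalso
  obtain ⟨x, hxA, hxp, hxc⟩ := hG.exists_central_mod hp A hAn hne
  obtain ⟨a, ha⟩ := (Subgroup.isCyclic_iff_exists_zpowers_eq_top A).1 hAcyc
  have haA : a ∈ A := ha ▸ Subgroup.mem_zpowers a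
  have hgen : ∀ b ∈ A, ∃ j : ℤ, a ^ j = b := fun b hb => by
    rw [← ha] at hb; exact hb
  have hax : a * x ≠ x * a := by
    intro hcom
    obtain ⟨N, hN, hNc, hAN, hxN⟩ := A.exists_normal_commute_of_central_mod hAn hAc x
      (fun b hb => by
        obtain ⟨j, rfl⟩ := hgen b hb
        exact (Commute.zpow_left hcom j).eq) hxc
    exact hxA (hmax ⟨hN, hNc⟩ hAN hxN)
  have := Fact.mk hp
  obtain ⟨n, hn⟩ := IsPGroup.iff_orderOf.1 hG a
  have hn0 : n ≠ 0 := by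
    rintro rfl
    rw [pow_zero, orderOf_eq_one_iff] at hn
    exact hax (by simp [hn])
  obtain ⟨k, hk⟩ := hgen _ (hAn.conj_mem a haA x)
  have hxact : ∀ b ∈ A, x * b * x⁻¹ = b ^ k := fun b hb => by
    obtain ⟨j, rfl⟩ := hgen b hb
    rw [← conj_zpow, ← hk, ← zpow_mul, ← zpow_mul, mul_comm]
  have hkp : (p : ℤ) ^ n ∣ k ^ p - 1 := by
    have hit : ∀ m : ℕ, x ^ m * a * (x ^ m)⁻¹ = a ^ (k ^ m) := by
      intro m
      induction m with
      | zero => simp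
      | succ m ih =>
        calc x ^ (m + 1) * a * (x ^ (m + 1))⁻¹ = x * (x ^ m * a * (x ^ m)⁻¹) * x⁻¹ := by
              rw [pow_succ']; group
          _ = a ^ (k ^ (m + 1)) := by
              rw [ih, hxact _ (zpow_mem haA _), ← zpow_mul, pow_succ]
    have h1 := hit p
    rw [hAc _ hxp a haA, mul_inv_cancel_right] at h1
    have h2 : a ^ (k ^ p - 1) = 1 := by rw [zpow_sub, ← h1]; simp
    have h3 := orderOf_dvd_iff_zpow_eq_one.2 h2
    rw [hn] at h3
    exact_mod_cast h3
  obtain ⟨hpk, hnk⟩ := Int.dvd_sub_one_of_dvd_pow_sub_one hp hodd hn0 hkp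
  have htors : ∀ b ∈ A, (b ^ (k - 1)) ^ p = 1 := fun b hb => by
    obtain ⟨j, rfl⟩ := hgen b hb
    have h1 : a ^ ((p : ℤ) * (k - 1)) = 1 := by
      rw [← orderOf_dvd_iff_zpow_eq_one, hn]; exact_mod_cast hnk
    rw [← zpow_natCast, ← zpow_mul, ← zpow_mul,
      show j * ((k - 1) * (p : ℤ)) = (p * (k - 1)) * j by ring, zpow_mul, h1, one_zpow]
  have hfix : ∀ c : G, c ^ p = 1 → c ^ k = c := fun c hc => by
    obtain ⟨l, hl⟩ := hpk
    rw [show k = p * l + 1 by linarith, zpow_add_one, zpow_mul, zpow_natCast, hc, one_zpow,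
      one_mul]
  have hcommy : ∀ y : G, (∀ b ∈ A, y * b * y⁻¹ = b ^ k) → ∀ c ∈ A, c ^ p = 1 →
      c * y = y * c := fun y hy c hc hcp => by
    have := hy c hc
    rw [hfix c hcp, mul_inv_eq_iff_eq_mul] at this
    exact this.symm
  have hpow : ∀ y : G, (∀ b ∈ A, y * b * y⁻¹ = b ^ k) → ∀ b ∈ A,
      (b * y) ^ p = b ^ p * y ^ p := fun y hy b hb => by
    have hcA : b ^ (k - 1) ∈ A := zpow_mem hb _
    have hcy := hcommy y hy _ hcA (htors b hb)
    rw [mul_pow_of_mul_eq_mul_mul (c := b ^ (k - 1)) ?_ (hAc _ hcA _ hb) hcy p]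
    · obtain ⟨m, hm⟩ := hp.dvd_choose_self (k := 2) (by norm_num)
        (hp.two_le.lt_of_ne fun h2 => by rw [← h2] at hodd; exact absurd hodd (by decide))
      rw [hm, pow_mul, htors b hb, one_pow, mul_one]
    · rw [mul_assoc, ← hcy, ← mul_assoc, ← zpow_one_add, add_sub_cancel, ← hy b hb]
      group
  obtain ⟨m, hm⟩ := hgen _ hxp
  have hpm : (p : ℤ) ∣ m := by
    by_contra hpm
    have hcop : IsCoprime m ((p : ℤ) ^ n) :=
      (((Nat.prime_iff_prime_int.1 hp).coprime_iff_not_dvd.2 hpm).symm).pow_right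
    obtain ⟨u, v, huv⟩ := hcop
    have h1 : a = (x ^ p) ^ u := by
      have h2 : a ^ ((p : ℤ) ^ n) = 1 := by
        have := pow_orderOf_eq_one a
        rw [hn] at this
        exact_mod_cast this
      rw [← hm, ← zpow_mul]
      conv_lhs => rw [← zpow_one a, ← huv, zpow_add, mul_comm v, zpow_mul a _ v, h2, one_zpow,
        mul_one, mul_comm]
    apply hax
    have h3 : Commute ((x ^ p) ^ u) x := ((Commute.refl x).pow_left p).zpow_left u
    rw [h1]
    exact h3.eq
  obtain ⟨l, rfl⟩ := hpm
  set b := a ^ (-l) with hb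
  have hbA : b ∈ A := zpow_mem haA _
  obtain ⟨y, hy⟩ : ∃ y, y = b * x := ⟨_, rfl⟩
  have hyp : y ^ p = 1 := by
    rw [hy, hpow x hxact b hbA, ← hm, hb, ← zpow_natCast, ← zpow_mul, ← zpow_add]
    rw [show -l * (p : ℤ) + p * l = 0 by ring, zpow_zero]
  have hyA : y ∉ A := fun hyA => hxA (by
    rw [hy] at hyA
    exact (A.mul_mem_cancel_left hbA).1 hyA)
  have hyact : ∀ d ∈ A, y * d * y⁻¹ = d ^ k := fun d hd => by
    calc y * d * y⁻¹ = b * (x * d * x⁻¹) * b⁻¹ := by rw [hy]; group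
      _ = d ^ k := by rw [hxact d hd, hAc b hbA _ (zpow_mem hd k), mul_inv_cancel_right]
  have hyc : ∀ g : G, g * y * g⁻¹ * y⁻¹ ∈ A := fun g => by
    have h1 : g * y * g⁻¹ * y⁻¹ = (g * b * g⁻¹) * (g * x * g⁻¹ * x⁻¹) * b⁻¹ := by
      rw [hy]; group
    rw [h1]
    exact mul_mem (mul_mem (hAn.conj_mem b hbA g) (hxc g)) (inv_mem hbA)
  let S : Subgroup G :=
    { carrier := {c | c ∈ A ∧ c ^ p = 1}
      one_mem' := ⟨one_mem A, one_pow p⟩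
      mul_mem' := fun {c d} hc hd => ⟨mul_mem hc.1 hd.1, by
        rw [Commute.mul_pow (hAc c hc.1 d hd.1), hc.2, hd.2, one_mul]⟩
      inv_mem' := fun {c} hc => ⟨inv_mem hc.1, by rw [inv_pow, hc.2, inv_one]⟩ }
  have hSn : S.Normal := ⟨fun c hc g => ⟨hAn.conj_mem c hc.1 g, by
    rw [conj_pow, hc.2, mul_one, mul_inv_cancel]⟩⟩
  obtain ⟨N, hNn, hNc, hSN, hyN⟩ := S.exists_normal_commute_of_central_mod hSn
    (fun c hc d hd => hAc c hc.1 d hd.1) y (fun c hc => hcommy y hyact c hc.1 hc.2)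
    (fun g => ⟨hyc g, by
      have h1 := hpow y hyact _ (hyc g)
      rwa [inv_mul_cancel_right, conj_pow, hyp, mul_one, mul_inv_cancel, mul_one, eq_comm] at h1⟩)
  have := h' N hNn hNc
  have hcS : a ^ (k - 1) ∈ S := ⟨zpow_mem haA _, htors a haA⟩
  have hc1 : a ^ (k - 1) ≠ 1 := fun h1 => by
    have h2 := hxact a haA
    rw [← sub_add_cancel k 1, zpow_add_one, h1, one_mul, mul_inv_eq_iff_eq_mul] at h2
    exact hax h2.symm
  obtain ⟨j, hj⟩ := IsCyclic.mem_zpowers_of_pow_prime_eq_one (G := N) hp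
    (c := ⟨_, hSN hcS⟩) (y := ⟨y, hyN⟩) (Subtype.ext hcS.2)
    (fun h1 => hc1 (congrArg Subtype.val h1)) (Subtype.ext hyp)
  have hj' : (a ^ (k - 1)) ^ j = y := congrArg Subtype.val hj
  exact hyA (hj' ▸ zpow_mem hcS.1 j)
end

section
/- Let p be an odd prime and let G be a finite metacyclic p-group, i.e. G possesses a normal cyclic subgroup N such that the quotient G/N is cyclic. Then G is powerful, i.e. the commutator subgroup [G,G] is contained in G^p, the subgroup generated by the p-th powers of elements of G. -/
theorem closure_pow_normal (G : Type*) [Group G] (n : ℕ) :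
    (Subgroup.closure {x : G | ∃ g : G, g ^ n = x}).Normal where
  conj_mem x hx g := by
    induction hx using Subgroup.closure_induction with
    | mem x hx =>
      obtain ⟨y, rfl⟩ := hx
      exact Subgroup.subset_closure ⟨g * y * g⁻¹, conj_pow⟩
    | one => simp
    | mul x y _ _ hx hy => rw [← conj_mul]; exact mul_mem hx hy
    | inv x _ hx => rw [← conj_inv]; exact inv_mem hx

theorem conj_pow_eq_zpow_pow {G : Type*} [Group G] {a g : G} {k : ℤ}
    (h : g * a * g⁻¹ = a ^ k) (i : ℕ) : g ^ i * a * (g ^ i)⁻¹ = a ^ (k ^ i) := by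
  induction i with
  | zero => simp
  | succ i ih =>
    calc g ^ (i + 1) * a * (g ^ (i + 1))⁻¹ = g * (g ^ i * a * (g ^ i)⁻¹) * g⁻¹ := by
          rw [pow_succ']; group
      _ = (g * a * g⁻¹) ^ (k ^ i) := by rw [ih, conj_zpow]
      _ = a ^ (k ^ (i + 1)) := by rw [h, ← zpow_mul, pow_succ']

/-- If conjugation by an element of a finite `p`-group maps `a` to a power of `a`, then it moves
`a` by the `p`-th power of a power of `a`. -/
theorem IsPGroup.exists_conj_eq_mul_zpow_pow {p : ℕ} (hp : p.Prime) {G : Type*} [Group G]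
    [Finite G] (hG : IsPGroup p G) {a g : G} {k : ℤ} (h : g * a * g⁻¹ = a ^ k) :
    ∃ c : ℤ, g * a * g⁻¹ = a * (a ^ c) ^ p := by
  have := Fact.mk hp
  by_cases ha : a = 1
  · exact ⟨0, by simp [ha]⟩
  have hpa : p ∣ orderOf a := by
    obtain ⟨j, hj⟩ := IsPGroup.iff_orderOf.mp hG a
    rw [hj]
    refine dvd_pow_self p ?_
    rintro rfl
    exact ha (orderOf_eq_one_iff.mp (by simpa using hj))
  obtain ⟨m, hm⟩ := hG g
  have hk := conj_pow_eq_zpow_pow h (p ^ m)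
  rw [hm, one_mul, inv_one, mul_one] at hk
  have hdvd : (p : ℤ) ∣ k ^ p ^ m - 1 :=
    (Int.natCast_dvd_natCast.mpr hpa).trans <| orderOf_dvd_iff_zpow_eq_one.mpr <| by
      rw [zpow_sub, ← hk, zpow_one, mul_inv_cancel]
  have hdvd' : (p : ℤ) ∣ k - 1 := by
    rw [← ZMod.intCast_zmod_eq_zero_iff_dvd] at hdvd ⊢
    push_cast at hdvd ⊢
    rwa [ZMod.pow_card_pow] at hdvd
  obtain ⟨c, hc⟩ := hdvd'
  refine ⟨c, ?_⟩
  rw [h, ← zpow_natCast, ← zpow_mul, ← zpow_one_add]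
  congr 1
  linarith

/-- For an odd prime `p`, a finite metacyclic `p`-group is powerful: if `G` has a
cyclic normal subgroup `N` with `G / N` cyclic, then `[G, G] ≤ G^p`. -/
theorem metacyclic_is_powerful
    (p : ℕ) (hp : p.Prime) (hodd : Odd p) (G : Type) [Group G] [Finite G]
    (hG : IsPGroup p G) (N : Subgroup G) (hN : N.Normal) (hNcyc : IsCyclic N)
    (hQcyc : IsCyclic (G ⧸ N)) :
    commutator G ≤ Subgroup.closure {x : G | ∃ g : G, g ^ p = x} := by
  set P := Subgroup.closure {x : G | ∃ g : G, g ^ p = x}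
  have : P.Normal := closure_pow_normal G p
  let π := QuotientGroup.mk' P
  have hπ : Function.Surjective π := QuotientGroup.mk'_surjective P
  obtain ⟨a, rfl⟩ := N.isCyclic_iff_exists_zpowers_eq_top.mp hNcyc
  set N := Subgroup.zpowers a
  have ha : π a ∈ Subgroup.center (G ⧸ P) := by
    rw [Subgroup.mem_center_iff]
    intro x
    obtain ⟨g, rfl⟩ := hπ x
    obtain ⟨k, hk⟩ := Subgroup.mem_zpowers_iff.mp
      (hN.conj_mem a (Subgroup.mem_zpowers a) g)
    obtain ⟨c, hc⟩ := hG.exists_conj_eq_mul_zpow_pow hp hk.symm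
    have hcP : π ((a ^ c) ^ p) = 1 :=
      (QuotientGroup.eq_one_iff _).mpr (Subgroup.subset_closure ⟨a ^ c, rfl⟩)
    have := congrArg π hc
    rwa [map_mul, map_mul, map_inv, map_mul, hcP, mul_one, mul_inv_eq_iff_eq_mul] at this
  have : (N.map π).Normal := hN.map π hπ
  have : IsCyclic ((G ⧸ P) ⧸ N.map π) :=
    isCyclic_of_surjective (QuotientGroup.map N (N.map π) π (Subgroup.le_comap_map π N)) <|
      QuotientGroup.map_surjective_of_surjective _ _ _
        ((QuotientGroup.mk_surjective).comp hπ) _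
  have hcomm : IsMulCommutative (G ⧸ P) := by
    refine (QuotientGroup.mk' (N.map π)).isMulCommutative_of_isCyclic_of_ker_le_center ?_
    rw [QuotientGroup.ker_mk', MonoidHom.map_zpowers]
    exact Subgroup.zpowers_le.mpr ha
  rw [commutator_def, Subgroup.commutator_le]
  intro x _ y _
  rw [← QuotientGroup.eq_one_iff]
  change π (x * y * x⁻¹ * y⁻¹) = 1
  rw [map_mul, map_mul, map_mul, map_inv, map_inv, hcomm.is_comm.comm (π x), mul_inv_cancel_right,
    mul_inv_cancel]
end

section
/- Let p be an odd prime and let G = ⟨a, b⟩ be a finite powerful p-group generated by two elements a and b, and suppose that G^p = ⟨a^p⟩, i.e. the subgroup generated by p-th powers of elements of G equals the cyclic subgroup generated by a^p. Then there exists an element c ∈ G with c^p = 1 such that G = ⟨a, c⟩. -/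
/-- If conjugation by `b⁻¹` raises `a` to the `r`-th power, the powers of `b * a ^ j` are given by
geometric sums in `r`. -/
theorem mul_zpow_pow_eq_geom_sum {G : Type*} [Group G] {a b : G} {r : ℤ}
    (h : b⁻¹ * a * b = a ^ r) (j : ℤ) (n : ℕ) :
    (b * a ^ j) ^ n = b ^ n * a ^ (j * ∑ i ∈ Finset.range n, r ^ i) := by
  have hconj (m : ℤ) : a ^ m * b = b * a ^ (r * m) := by
    rw [zpow_mul, ← h]
    have := conj_zpow (a := b⁻¹) (b := a) (i := m)
    rw [inv_inv] at this
    rw [this]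
    group
  induction n with
  | zero => simp
  | succ n ih =>
    rw [pow_succ, ih, geom_sum_succ, mul_assoc, ← mul_assoc (a ^ _) b, hconj, mul_assoc,
      ← zpow_add, ← mul_assoc, ← pow_succ]
    congr 2
    ring

theorem exists_two_mul_geom_sum_eq (q t : ℤ) (n : ℕ) :
    ∃ m : ℤ, 2 * ∑ i ∈ Finset.range n, (1 + q * t) ^ i
      = 2 * n + n * (n - 1) * (q * t) + 2 * q ^ 2 * m := by
  have hpow (i : ℕ) : ∃ m : ℤ, (1 + q * t) ^ i = 1 + i * (q * t) + q ^ 2 * m := by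
    induction i with
    | zero => exact ⟨0, by simp⟩
    | succ i ih =>
      obtain ⟨m, hm⟩ := ih
      refine ⟨m + i * t ^ 2 + q * t * m, ?_⟩
      rw [pow_succ, hm]
      push_cast
      ring
  induction n with
  | zero => exact ⟨0, by simp⟩
  | succ n ih =>
    obtain ⟨m, hm⟩ := ih
    obtain ⟨m', hm'⟩ := hpow n
    refine ⟨m + m', ?_⟩
    rw [Finset.sum_range_succ, mul_add, hm, hm']
    push_cast
    ring

/-- For odd `p` and `r ≡ 1 [ZMOD p]`, the sum `1 + r + ⋯ + r ^ (p - 1)` is `p` modulo `p ^ 2`. -/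
theorem exists_geom_sum_eq_mul_one_add {p : ℕ} (hodd : Odd p) (t : ℤ) :
    ∃ w : ℤ, ∑ i ∈ Finset.range p, (1 + p * t) ^ i = p * (1 + p * w) := by
  obtain ⟨m, hm⟩ := exists_two_mul_geom_sum_eq p t p
  obtain ⟨k, hk⟩ := hodd
  have hk' : (p : ℤ) = 2 * k + 1 := by exact_mod_cast hk
  refine ⟨k * t + m, ?_⟩
  have h2 : (p : ℤ) - 1 = 2 * k := by linarith
  rw [h2] at hm
  linarith

/-- Let `p` be an odd prime and let `G = ⟨a, b⟩` be a finite powerful `p`-group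
(i.e. `[G,G] ≤ G^p`) with `G^p = ⟨a^p⟩`. Then there is `c ∈ G` with `c^p = 1` and
`G = ⟨a, c⟩`. -/
theorem exists_order_p_generator
    (p : ℕ) (hp : p.Prime) (hodd : Odd p) (G : Type) [Group G] [Finite G]
    (hG : IsPGroup p G) (hpowerful : commutator G ≤ powerSubgroup G p)
    (a b : G) (hgen : Subgroup.closure ({a, b} : Set G) = ⊤)
    (hGp : powerSubgroup G p = Subgroup.zpowers (a ^ p)) :
    ∃ c : G, c ^ p = 1 ∧ Subgroup.closure ({a, c} : Set G) = ⊤ := by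
  obtain ⟨k, hk⟩ : ∃ k : ℤ, (a ^ p) ^ k = b ^ p := by
    rw [← Subgroup.mem_zpowers_iff, ← hGp]
    exact Subgroup.subset_closure ⟨b, rfl⟩
  obtain ⟨t, ht⟩ : ∃ t : ℤ, (a ^ p) ^ t = a⁻¹ * b⁻¹ * a * b := by
    rw [← Subgroup.mem_zpowers_iff, ← hGp]
    apply hpowerful
    simpa [commutator_def, commutatorElement_def] using
      Subgroup.commutator_mem_commutator (Subgroup.mem_top a⁻¹) (Subgroup.mem_top b⁻¹)
  have hr : b⁻¹ * a * b = a ^ (1 + p * t : ℤ) := by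
    rw [zpow_add, zpow_one, zpow_mul, zpow_natCast, ht]
    group
  obtain ⟨w, hw⟩ := exists_geom_sum_eq_mul_one_add hodd t
  obtain ⟨n, hn⟩ := hG a
  obtain ⟨x, y, hxy⟩ : IsCoprime (1 + p * w : ℤ) ((p : ℤ) ^ n) :=
    IsCoprime.pow_right ⟨1, -w, by ring⟩
  refine ⟨b * a ^ (-k * x), ?_, ?_⟩
  · rw [mul_zpow_pow_eq_geom_sum hr, hw, ← hk, ← zpow_natCast a p, ← zpow_mul, ← zpow_add,
      show (p * k + -k * x * (p * (1 + p * w)) : ℤ) = ((p ^ n : ℕ) : ℤ) * (p * k * y) by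
        push_cast
        linear_combination (-(p : ℤ) * k) * hxy,
      zpow_mul, zpow_natCast, hn, one_zpow]
  · rw [eq_top_iff, ← hgen, Subgroup.closure_le, Set.insert_subset_iff, Set.singleton_subset_iff]
    have ha : a ∈ Subgroup.closure {a, b * a ^ (-k * x)} := Subgroup.subset_closure (by simp)
    refine ⟨ha, ?_⟩
    rw [SetLike.mem_coe, ← Subgroup.mul_mem_cancel_right _ (zpow_mem ha (-k * x))]
    exact Subgroup.subset_closure (by simp)
end

section
/- Let p be a prime and let G be a finite powerful p-group of exponent p^e (for some e ≥ 1). Then for all g, h ∈ G, (gh)^{p^{e-1}} = g^{p^{e-1}} h^{p^{e-1}}. -/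
/-- A finite `p`-group `G` is *powerful* if `[G,G] ≤ G^p` for `p` odd, and
`[G,G] ≤ G^4` for `p = 2`. -/
def IsPowerful (p : ℕ) (G : Type*) [Group G] : Prop :=
  if p = 2 then commutator G ≤ powerSubgroup G 4 else commutator G ≤ powerSubgroup G p

open scoped commutatorElement

/-- The subgroup generated by the `n`-th powers of the elements of `N`. -/
def Subgroup.powClosure {G : Type*} [Group G] (N : Subgroup G) (n : ℕ) : Subgroup G :=
  Subgroup.closure {x : G | ∃ g ∈ N, g ^ n = x}

namespace Subgroup

variable {G : Type*} [Group G]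

lemma pow_mem_powClosure {N : Subgroup G} {x : G} (hx : x ∈ N) (n : ℕ) :
    x ^ n ∈ N.powClosure n :=
  subset_closure ⟨x, hx, rfl⟩

lemma powClosure_le_iff {N K : Subgroup G} {n : ℕ} :
    N.powClosure n ≤ K ↔ ∀ x ∈ N, x ^ n ∈ K := by
  rw [powClosure, closure_le]
  constructor
  · exact fun h x hx => h ⟨x, hx, rfl⟩
  · rintro h _ ⟨x, hx, rfl⟩
    exact h x hx

lemma powClosure_le (N : Subgroup G) (n : ℕ) : N.powClosure n ≤ N :=
  powClosure_le_iff.2 fun _ hx => N.pow_mem hx n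

lemma map_powClosure {H : Type*} [Group H] (f : G →* H) (N : Subgroup G) (n : ℕ) :
    (N.powClosure n).map f = (N.map f).powClosure n := by
  apply le_antisymm
  · rw [map_le_iff_le_comap, powClosure_le_iff]
    intro x hx
    rw [mem_comap, map_pow]
    exact pow_mem_powClosure (mem_map_of_mem f hx) n
  · rw [powClosure_le_iff]
    rintro _ ⟨x, hx, rfl⟩
    rw [← map_pow]
    exact mem_map_of_mem f (pow_mem_powClosure hx n)

instance powClosure_normal (N : Subgroup G) [hN : N.Normal] (n : ℕ) :
    (N.powClosure n).Normal := by
  refine ⟨fun x hx g => ?_⟩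
  have h : N.powClosure n ≤ (N.powClosure n).comap (MulAut.conj g).toMonoidHom := by
    rw [powClosure_le_iff]
    intro y hy
    rw [mem_comap, map_pow]
    exact pow_mem_powClosure (hN.conj_mem y hy g) n
  exact h hx

end Subgroup

open Subgroup

/-- The exponent appearing in the definition of a powerful `p`-group. -/
def powerfulExponent (p : ℕ) : ℕ := if p = 2 then 4 else p

section ClassTwo

variable {G : Type*} [Group G]

lemma pow_mul_eq_commutatorElement_pow_mul {x y : G}
    (hy : Commute ⁅y, x⁆ y) (n : ℕ) : y ^ n * x = ⁅y, x⁆ ^ n * x * y ^ n := by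
  induction n with
  | zero => simp
  | succ n ih =>
    have h : y * x = ⁅y, x⁆ * x * y := by simp [commutatorElement_def]
    calc y ^ (n + 1) * x = y ^ n * (y * x) := by rw [pow_succ, mul_assoc]
      _ = y ^ n * ⁅y, x⁆ * x * y := by rw [h]; simp only [mul_assoc]
      _ = ⁅y, x⁆ * (y ^ n * x) * y := by
        rw [← (hy.pow_right n).eq]; simp only [mul_assoc]
      _ = ⁅y, x⁆ ^ (n + 1) * x * y ^ (n + 1) := by
        rw [ih, pow_succ', pow_succ]; simp only [mul_assoc]

lemma mul_pow_eq_mul_commutatorElement_pow {x y : G} (hx : Commute ⁅y, x⁆ x)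
    (hy : Commute ⁅y, x⁆ y) (n : ℕ) :
    (x * y) ^ n = x ^ n * y ^ n * ⁅y, x⁆ ^ n.choose 2 := by
  induction n with
  | zero => simp
  | succ n ih =>
    have hxy : Commute (⁅y, x⁆ ^ n.choose 2) (x * y) := (hx.mul_right hy).pow_left _
    have hz : Commute (⁅y, x⁆ ^ n) (x * y ^ (n + 1)) :=
      (hx.mul_right (hy.pow_right _)).pow_left _
    calc (x * y) ^ (n + 1)
        = x ^ n * y ^ n * (⁅y, x⁆ ^ n.choose 2 * (x * y)) := by rw [pow_succ, ih, mul_assoc]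
      _ = x ^ n * (y ^ n * x) * y * ⁅y, x⁆ ^ n.choose 2 := by
        rw [hxy.eq]; simp only [mul_assoc]
      _ = x ^ n * (⁅y, x⁆ ^ n * (x * y ^ (n + 1))) * ⁅y, x⁆ ^ n.choose 2 := by
        rw [pow_mul_eq_commutatorElement_pow_mul hy, pow_succ y]; simp only [mul_assoc]
      _ = x ^ (n + 1) * y ^ (n + 1) * ⁅y, x⁆ ^ (n + 1).choose 2 := by
        rw [hz.eq, Nat.choose_succ_succ' n 1, Nat.choose_one_right, pow_add ⁅y, x⁆, pow_succ x]
        simp only [mul_assoc]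

lemma conj_pow_eq_commutatorElement_mul_pow (g x : G) (n : ℕ) :
    g * x ^ n * g⁻¹ = (⁅g, x⁆ * x) ^ n := by
  rw [← conj_pow]; simp [commutatorElement_def]

lemma Subgroup.commutatorElement_mem_right {N : Subgroup G} [hN : N.Normal] {x : G}
    (hx : x ∈ N) (g : G) : ⁅g, x⁆ ∈ N :=
  N.mul_mem (hN.conj_mem x hx g) (N.inv_mem hx)

lemma Subgroup.commute_of_mem_center {c : G} (hc : c ∈ center G) (x : G) : Commute c x :=
  (mem_center_iff.1 hc x).symm

lemma mem_center_of_conj_eq {x : G} (h : ∀ g, g * x * g⁻¹ = x) : x ∈ center G :=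
  mem_center_iff.2 fun g => mul_inv_eq_iff_eq_mul.1 (h g)

lemma Nat.Prime.dvd_choose_two {p : ℕ} (hp : p.Prime) (h2 : p ≠ 2) : p ∣ p.choose 2 :=
  hp.dvd_choose_self two_ne_zero (lt_of_le_of_ne hp.two_le h2.symm)

lemma powClosure_le_center_of_odd {p : ℕ} (hp : p.Prime) (h2 : p ≠ 2) {N : Subgroup G}
    [N.Normal] (hN : ∀ x ∈ N, ∀ g : G, ⁅g, x⁆ ∈ N.powClosure p)
    (hpow : ∀ m ∈ N.powClosure p, m ^ p = 1)
    (hcen : ∀ m ∈ N.powClosure p, ∀ g : G, ⁅g, m⁆ ∈ center G) :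
    N.powClosure p ≤ center G := by
  rw [powClosure_le_iff]
  refine fun x hx => mem_center_of_conj_eq fun g => ?_
  have hc := hN x hx g
  have hz := commute_of_mem_center (hcen _ hc x)
  obtain ⟨k, hk⟩ := hp.dvd_choose_two h2
  rw [conj_pow_eq_commutatorElement_mul_pow, mul_pow_eq_mul_commutatorElement_pow (hz _) (hz _),
    hpow _ hc, hk, pow_mul, hpow _ (commutatorElement_mem_right hc x)]
  simp

lemma powClosure_four_le_powClosure_two (N : Subgroup G) :
    N.powClosure 4 ≤ (N.powClosure 2).powClosure 2 := by
  rw [powClosure_le_iff]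
  intro x hx
  rw [show 4 = 2 * 2 from rfl, pow_mul]
  exact pow_mem_powClosure (pow_mem_powClosure hx 2) 2

lemma powClosure_two_le_center {N : Subgroup G} [N.Normal]
    (hN : ∀ x ∈ N, ∀ g : G, ⁅g, x⁆ ∈ N.powClosure 4)
    (hpow : ∀ m ∈ N.powClosure 2, m ^ 4 = 1)
    (hcen : ∀ m ∈ N.powClosure 2, ∀ g : G, ⁅g, m⁆ ∈ center G) :
    N.powClosure 2 ≤ center G := by
  have hle : N.powClosure 4 ≤ N.powClosure 2 :=
    (powClosure_four_le_powClosure_two N).trans (powClosure_le _ _)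
  have hsq : ∀ m ∈ N.powClosure 2, ∀ g : G, ⁅g, m ^ 2⁆ = ⁅g, m⁆ ^ 2 := by
    intro m hm g
    rw [commutatorElement_def, conj_pow_eq_commutatorElement_mul_pow,
      (commute_of_mem_center (hcen m hm g) m).mul_pow, mul_inv_cancel_right]
  have hcomm : ∀ x ∈ N, ∀ y ∈ N, Commute (x ^ 4) (y ^ 4) := by
    intro x hx y hy
    have hx2 := pow_mem_powClosure hx 2
    have hy2 := pow_mem_powClosure hy 2
    rw [← commutatorElement_eq_one_iff_commute, show 4 = 2 * 2 from rfl, pow_mul, pow_mul,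
      hsq _ hy2, ← commutatorElement_inv, hsq _ hx2, inv_pow, ← pow_mul,
      hpow _ (commutatorElement_mem_right hx2 _), inv_one]
  have hinv : ∀ c ∈ N.powClosure 4, c ^ 2 = 1 := by
    have hab : ∀ a ∈ N.powClosure 4, ∀ b ∈ N.powClosure 4, Commute a b := by
      have h1 : ∀ x ∈ N, N.powClosure 4 ≤ centralizer {x ^ 4} := by
        intro x hx
        rw [powClosure_le_iff]
        exact fun y hy => mem_centralizer_singleton_iff.2 (hcomm y hy x hx).eq
      intro a ha b hb
      have h2 : N.powClosure 4 ≤ centralizer {b} := by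
        rw [powClosure_le_iff]
        exact fun x hx => mem_centralizer_singleton_iff.2
          (mem_centralizer_singleton_iff.1 (h1 x hx hb)).symm
      exact mem_centralizer_singleton_iff.1 (h2 ha)
    intro c hc
    induction hc using closure_induction with
    | mem x hx =>
      obtain ⟨y, hy, rfl⟩ := hx
      rw [← pow_mul, show 4 * 2 = 2 * 4 from rfl, pow_mul, hpow _ (pow_mem_powClosure hy 2)]
    | one => simp
    | mul a b ha hb iha ihb => rw [(hab a ha b hb).mul_pow, iha, ihb, one_mul]
    | inv a ha iha => rw [inv_pow, iha, inv_one]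
  have hconj : ∀ x ∈ N, ∀ g, g * x ^ 2 * g⁻¹ = x ^ 2 * ⁅x, ⁅g, x⁆⁆ := by
    intro x hx g
    have hc := hN x hx g
    have hz := commute_of_mem_center (hcen _ (hle hc) x)
    rw [conj_pow_eq_commutatorElement_mul_pow, mul_pow_eq_mul_commutatorElement_pow (hz _) (hz _),
      hinv _ hc]
    simp
  have hfour : N.powClosure 4 ≤ center G := by
    rw [powClosure_le_iff]
    refine fun x hx => mem_center_of_conj_eq fun g => ?_
    have hc := hle (hN x hx g)
    have hz := commute_of_mem_center (hcen _ hc x)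
    rw [show 4 = 2 * 2 from rfl, pow_mul, ← conj_pow, hconj x hx, (hz _).symm.mul_pow,
      ← hsq _ hc, hinv _ (hN x hx g), commutatorElement_one_right, mul_one]
  rw [powClosure_le_iff]
  refine fun x hx => mem_center_of_conj_eq fun g => ?_
  rw [hconj x hx, (commute_of_mem_center (hfour (hN x hx g)) x).symm.commutator_eq, mul_one]

lemma powClosure_le_center {p : ℕ} (hp : p.Prime) {N : Subgroup G} [N.Normal]
    (hN : ∀ x ∈ N, ∀ g : G, ⁅g, x⁆ ∈ N.powClosure (powerfulExponent p))
    (hpow : ∀ m ∈ N.powClosure p, m ^ powerfulExponent p = 1)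
    (hcen : ∀ m ∈ N.powClosure p, ∀ g : G, ⁅g, m⁆ ∈ center G) :
    N.powClosure p ≤ center G := by
  by_cases h2 : p = 2
  · subst h2
    exact powClosure_two_le_center hN hpow hcen
  · simp only [powerfulExponent, if_neg h2] at hN hpow
    exact powClosure_le_center_of_odd hp h2 hN hpow hcen

end ClassTwo

section PowerfullyEmbedded

variable {G : Type*} [Group G]

/-- `N` is powerfully embedded in `G`: `[N, G] ≤ N ^ p` for `p` odd, `[N, G] ≤ N ^ 4` for
`p = 2`. -/
def IsPowerfullyEmbedded (p : ℕ) (N : Subgroup G) : Prop :=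
  ∀ x ∈ N, ∀ g : G, ⁅g, x⁆ ∈ N.powClosure (powerfulExponent p)

lemma Subgroup.eq_bot_of_le_commutator_top [Group.IsNilpotent G] {H : Subgroup G}
    (h : H ≤ ⁅H, (⊤ : Subgroup G)⁆) : H = ⊥ := by
  have hle : ∀ n, H ≤ lowerCentralSeries (⊤ : Subgroup G) n := by
    intro n
    induction n with
    | zero => simp
    | succ n ih => exact h.trans (commutator_mono ih le_rfl)
  obtain ⟨n, hn⟩ := Subgroup.nilpotent_iff_lowerCentralSeries.1 ‹Group.IsNilpotent G›
  exact le_bot_iff.1 (hn ▸ hle n)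

lemma Subgroup.le_of_le_sup_commutator_top [Group.IsNilpotent G] {H K : Subgroup G} [K.Normal]
    (h : H ≤ K ⊔ ⁅H, (⊤ : Subgroup G)⁆) : H ≤ K := by
  have hbot : H.map (QuotientGroup.mk' K) = ⊥ := by
    apply eq_bot_of_le_commutator_top
    have h' := map_mono (f := QuotientGroup.mk' K) h
    rwa [map_sup, map_commutator, QuotientGroup.map_mk'_self, bot_sup_eq,
      map_top_of_surjective _ (QuotientGroup.mk'_surjective K)] at h'
  rwa [map_eq_bot_iff, QuotientGroup.ker_mk'] at hbot

lemma IsPowerfullyEmbedded.powClosure [Group.IsNilpotent G] {p : ℕ} (hp : p.Prime)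
    {N : Subgroup G} [N.Normal] (hN : IsPowerfullyEmbedded p N) :
    IsPowerfullyEmbedded p (N.powClosure p) := by
  set M := N.powClosure p
  set K := M.powClosure (powerfulExponent p)
  set L := K ⊔ ⁅⁅(⊤ : Subgroup G), M⁆, (⊤ : Subgroup G)⁆
  set f := QuotientGroup.mk' L with hf
  have hsurj : Function.Surjective f := QuotientGroup.mk'_surjective L
  have hker : ∀ x ∈ L, f x = 1 := fun x hx => (QuotientGroup.eq_one_iff x).2 hx
  have hnorm : (N.map f).Normal := Normal.map inferInstance f hsurj
  have hcenter : (N.map f).powClosure p ≤ center (G ⧸ L) := by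
    apply powClosure_le_center hp
    · rintro _ ⟨x, hx, rfl⟩ g
      obtain ⟨g, rfl⟩ := hsurj g
      rw [← map_commutatorElement, ← map_powClosure]
      exact mem_map_of_mem f (hN x hx g)
    · rw [← map_powClosure]
      rintro _ ⟨m, hm, rfl⟩
      rw [← map_pow]
      exact hker _ (le_sup_left (a := K) (pow_mem_powClosure hm _))
    · rw [← map_powClosure]
      rintro _ ⟨m, hm, rfl⟩ g
      obtain ⟨g, rfl⟩ := hsurj g
      rw [mem_center_iff]
      intro k
      obtain ⟨k, rfl⟩ := hsurj k
      rw [← map_commutatorElement]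
      refine (commutatorElement_eq_one_iff_mul_comm.1 ?_).symm
      rw [← map_commutatorElement]
      exact hker _ (le_sup_right (a := K)
        (commutator_mem_commutator (commutator_mem_commutator (mem_top g) hm) (mem_top k)))
  have hle : ⁅(⊤ : Subgroup G), M⁆ ≤ L := by
    rw [commutator_le]
    intro g _ m hm
    rw [← QuotientGroup.ker_mk' L, MonoidHom.mem_ker, ← hf, map_commutatorElement,
      commutatorElement_eq_one_iff_mul_comm]
    exact mem_center_iff.1 (hcenter (map_powClosure f N p ▸ mem_map_of_mem f hm)) (f g)
  intro m hm g
  exact le_of_le_sup_commutator_top hle (commutator_mem_commutator (mem_top g) hm)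

lemma IsPowerfullyEmbedded.commutatorElement_mem {p : ℕ} {N : Subgroup G}
    (hN : IsPowerfullyEmbedded p N) {x : G} (hx : x ∈ N) (g : G) :
    ⁅g, x⁆ ∈ N.powClosure p := by
  have h := hN x hx g
  by_cases h2 : p = 2
  · subst h2
    exact powClosure_le _ _ (powClosure_four_le_powClosure_two N h)
  · simpa only [powerfulExponent, if_neg h2] using h

lemma IsPowerfullyEmbedded.mul_pow [Group.IsNilpotent G] {p : ℕ} (hp : p.Prime)
    {N : Subgroup G} [N.Normal] (hN : IsPowerfullyEmbedded p N) {x y : G} (hx : x ∈ N) :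
    ∃ z ∈ (N.powClosure p).powClosure p, (x * y) ^ p = x ^ p * y ^ p * z := by
  set K := (N.powClosure p).powClosure p
  have hc := hN.commutatorElement_mem hx y
  have hcomm : ∀ g : G, Commute (⁅(y : G ⧸ K), (x : G ⧸ K)⁆) (g : G ⧸ K) := by
    intro g
    refine (commutatorElement_eq_one_iff_commute.1 ?_).symm
    exact (QuotientGroup.eq_one_iff ⁅g, ⁅y, x⁆⁆).2 ((hN.powClosure hp).commutatorElement_mem hc g)
  have hpow : ⁅(y : G ⧸ K), (x : G ⧸ K)⁆ ^ p.choose 2 = 1 := by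
    by_cases h2 : p = 2
    · subst h2
      rw [Nat.choose_self, pow_one]
      exact (QuotientGroup.eq_one_iff ⁅y, x⁆).2 (powClosure_four_le_powClosure_two N (hN x hx y))
    · obtain ⟨k, hk⟩ := hp.dvd_choose_two h2
      rw [hk, pow_mul]
      have h1 : ⁅(y : G ⧸ K), (x : G ⧸ K)⁆ ^ p = 1 :=
        (QuotientGroup.eq_one_iff (⁅y, x⁆ ^ p)).2 (pow_mem_powClosure hc p)
      rw [h1, one_pow]
  refine ⟨(x ^ p * y ^ p)⁻¹ * (x * y) ^ p, ?_, by rw [mul_inv_cancel_left]⟩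
  rw [← QuotientGroup.eq]
  have h := mul_pow_eq_mul_commutatorElement_pow (hcomm x) (hcomm y) p
  rw [hpow, mul_one] at h
  exact h.symm

end PowerfullyEmbedded

section PowerSeries

variable {G : Type*} [Group G]

/-- The descending series `G, G ^ p, (G ^ p) ^ p, …`. -/
def powClosureSeries (G : Type*) [Group G] (p : ℕ) : ℕ → Subgroup G
  | 0 => ⊤
  | n + 1 => (powClosureSeries G p n).powClosure p

instance powClosureSeries_normal (p n : ℕ) : (powClosureSeries G p n).Normal := by
  induction n with
  | zero => exact inferInstanceAs (⊤ : Subgroup G).Normal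
  | succ n ih => exact powClosure_normal _ p

lemma pow_mem_powClosureSeries (p n : ℕ) (x : G) : x ^ p ^ n ∈ powClosureSeries G p n := by
  induction n with
  | zero => exact mem_top _
  | succ n ih =>
    rw [pow_succ, pow_mul]
    exact pow_mem_powClosure ih p

lemma IsPowerful.isPowerfullyEmbedded_powClosureSeries [Group.IsNilpotent G] {p : ℕ}
    (hp : p.Prime) (hG : IsPowerful p G) (n : ℕ) :
    IsPowerfullyEmbedded p (powClosureSeries G p n) := by
  induction n with
  | zero =>
    intro x _ g
    have h : commutator G ≤ powerSubgroup G (powerfulExponent p) := by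
      unfold IsPowerful at hG
      unfold powerfulExponent
      split_ifs at hG ⊢ <;> exact hG
    have h' : powerSubgroup G (powerfulExponent p) ≤
        (powClosureSeries G p 0).powClosure (powerfulExponent p) := by
      rw [powerSubgroup, closure_le]
      rintro _ ⟨y, rfl⟩
      exact pow_mem_powClosure (mem_top y) _
    exact h' (h (commutator_mem_commutator (mem_top g) (mem_top x)))
  | succ n ih => exact ih.powClosure hp

lemma IsPowerful.mul_pow_prime_pow [Group.IsNilpotent G] {p : ℕ} (hp : p.Prime)
    (hG : IsPowerful p G) (n : ℕ) (x y : G) :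
    ∃ z ∈ powClosureSeries G p (n + 1), (x * y) ^ p ^ n = x ^ p ^ n * y ^ p ^ n * z := by
  induction n with
  | zero => exact ⟨1, one_mem _, by simp⟩
  | succ n ih =>
    obtain ⟨z, hz, h⟩ := ih
    have hN := hG.isPowerfullyEmbedded_powClosureSeries hp n
    have hx := pow_mem_powClosureSeries p n x
    have hy := pow_mem_powClosureSeries p n y
    obtain ⟨z₁, hz₁, h₁⟩ := hN.mul_pow hp (y := z) (mul_mem hx hy)
    obtain ⟨z₂, hz₂, h₂⟩ := hN.mul_pow hp (y := y ^ p ^ n) hx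
    refine ⟨z₂ * z ^ p * z₁, mul_mem (mul_mem hz₂ (pow_mem_powClosure hz p)) hz₁, ?_⟩
    rw [pow_succ, pow_mul, h, h₁, h₂, pow_mul, pow_mul]
    simp only [mul_assoc]

lemma IsPowerful.exists_pow_mul_of_mem_powClosureSeries [Group.IsNilpotent G] {p : ℕ}
    (hp : p.Prime) (hG : IsPowerful p G) (n : ℕ) {a : G} (ha : a ∈ powClosureSeries G p n) :
    ∃ x, ∃ z ∈ powClosureSeries G p (n + 1), a = x ^ p ^ n * z := by
  induction n generalizing a with
  | zero => exact ⟨a, 1, one_mem _, by simp⟩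
  | succ n ih =>
    have hnorm := powClosureSeries_normal (G := G) p (n + 2)
    induction ha using closure_induction with
    | mem b hb =>
      obtain ⟨b, hb, rfl⟩ := hb
      obtain ⟨x, z, hz, rfl⟩ := ih hb
      obtain ⟨w, hw, h⟩ := (hG.isPowerfullyEmbedded_powClosureSeries hp n).mul_pow hp (y := z)
        (pow_mem_powClosureSeries p n x)
      refine ⟨x, z ^ p * w, mul_mem (pow_mem_powClosure hz p) hw, ?_⟩
      rw [h, pow_succ, pow_mul, mul_assoc]
    | one => exact ⟨1, 1, one_mem _, by simp⟩
    | mul a b _ _ iha ihb =>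
      obtain ⟨x, z, hz, rfl⟩ := iha
      obtain ⟨y, w, hw, rfl⟩ := ihb
      obtain ⟨v, hv, h⟩ := hG.mul_pow_prime_pow hp (n + 1) x y
      refine ⟨x * y, v⁻¹ * ((y ^ p ^ (n + 1))⁻¹ * z * y ^ p ^ (n + 1) * w),
        mul_mem (inv_mem hv) (mul_mem (hnorm.conj_mem' z hz _) hw), ?_⟩
      rw [h]
      group
    | inv a _ iha =>
      obtain ⟨x, z, hz, rfl⟩ := iha
      refine ⟨x⁻¹, x ^ p ^ (n + 1) * z⁻¹ * (x ^ p ^ (n + 1))⁻¹,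
        hnorm.conj_mem _ (inv_mem hz) _, ?_⟩
      rw [inv_pow]
      simp [mul_assoc]

lemma IsPGroup.subsingleton_of_powClosure_eq_top [Finite G] {p : ℕ} [Fact p.Prime]
    (hG : IsPGroup p G) (h : (⊤ : Subgroup G).powClosure p = ⊤) : Subsingleton G := by
  by_contra hne
  rw [not_subsingleton_iff_nontrivial] at hne
  have hnil := hG.isNilpotent
  refine (Group.IsSolvable.commutator_lt_top_of_nontrivial G).ne (top_unique fun x _ => ?_)
  have hsurj : Function.Surjective (powMonoidHom p : Abelianization G →* Abelianization G) := by
    have hle : (⊤ : Subgroup G).powClosure p ≤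
        (powMonoidHom p : Abelianization G →* Abelianization G).range.comap Abelianization.of :=
      powClosure_le_iff.2 fun y _ => ⟨Abelianization.of y, by simp⟩
    intro a
    obtain ⟨y, rfl⟩ := QuotientGroup.mk_surjective a
    exact hle (by rw [h]; exact mem_top y)
  have hinj := Finite.injective_iff_surjective.2 hsurj
  have hone : ∀ (k : ℕ) (a : Abelianization G), a ^ p ^ k = 1 → a = 1 := by
    intro k
    induction k with
    | zero => intro a ha; simpa using ha
    | succ k ih =>
      intro a ha
      refine ih a (hinj ?_)
      rw [powMonoidHom_apply, ← pow_mul, ← pow_succ, ha, map_one]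
  obtain ⟨k, hk⟩ := hG x
  have hx : Abelianization.of x = 1 := hone k _ (by rw [← map_pow, hk, map_one])
  exact (QuotientGroup.eq_one_iff x).1 hx

lemma IsPGroup.eq_bot_of_le_powClosure [Finite G] {p : ℕ} [Fact p.Prime] (hG : IsPGroup p G)
    {N : Subgroup G} (h : N ≤ N.powClosure p) : N = ⊥ := by
  have hN : (⊤ : Subgroup N).powClosure p = ⊤ := by
    apply map_injective N.subtype_injective
    rw [map_powClosure, ← MonoidHom.range_eq_map, N.range_subtype]
    exact le_antisymm (powClosure_le _ _) h
  have := (hG.to_subgroup N).subsingleton_of_powClosure_eq_top hN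
  exact eq_bot_of_subsingleton N

end PowerSeries

/-- A powerful `p`-group of exponent `p^e` (with `e ≥ 1`) is `p^(e-1)`-abelian:
`(g * h) ^ p ^ (e - 1) = g ^ p ^ (e - 1) * h ^ p ^ (e - 1)` for all `g, h`. -/
theorem powerful_pow_exp_pred_mul
    (p : ℕ) (hp : p.Prime) (G : Type) [Group G] [Finite G]
    (hG : IsPGroup p G) (hpowerful : IsPowerful p G)
    (e : ℕ) (he : 1 ≤ e) (hexp : Monoid.exponent G = p ^ e) (g h : G) :
    (g * h) ^ p ^ (e - 1) = g ^ p ^ (e - 1) * h ^ p ^ (e - 1) := by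
  have : Fact p.Prime := ⟨hp⟩
  have := hG.isNilpotent
  have hbot : powClosureSeries G p e = ⊥ := by
    refine hG.eq_bot_of_le_powClosure fun a ha => ?_
    obtain ⟨x, z, hz, rfl⟩ := hpowerful.exists_pow_mul_of_mem_powClosureSeries hp e ha
    rw [← hexp, Monoid.pow_exponent_eq_one, one_mul]
    exact hz
  obtain ⟨z, hz, hgh⟩ := hpowerful.mul_pow_prime_pow hp (e - 1) g h
  rw [Nat.sub_add_cancel he, hbot, mem_bot] at hz
  rw [hgh, hz, mul_one]
end

section
/- Let p be a prime, let G be a finite powerful p-group and let H be a subgroup of G whose minimal number of generators is r. Then there exist elements a_1, …, a_r ∈ G whose images in the quotient group G/G^p are linearly independent over 𝔽_p; equivalently, the subgroup of G/G^p generated by the images of a_1, …, a_r has order p^r. (Here G^p, the subgroup generated by p-th powers, is normal in G.) -/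
section GroupIdentities

open Subgroup
open scoped commutatorElement

variable {G : Type*} [Group G]

theorem pow_mul_eq_of_mul_comm_eq {x y z : G} (hy : Commute z y) (h : y * x = z * x * y)
    (n : ℕ) : y ^ n * x = z ^ n * x * y ^ n := by
  induction n with
  | zero => simp
  | succ n ih =>
    calc y ^ (n + 1) * x = y * z ^ n * x * y ^ n := by rw [pow_succ', mul_assoc, ih]; group
      _ = z ^ n * (y * x) * y ^ n := by rw [(hy.pow_left n).symm.eq]; group
      _ = z ^ (n + 1) * x * y ^ (n + 1) := by rw [h, pow_succ, pow_succ' y]; group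

theorem mul_pow_eq_of_mul_comm_eq {x y z : G} (hx : Commute z x) (hy : Commute z y)
    (h : y * x = z * x * y) (n : ℕ) : (x * y) ^ n = x ^ n * y ^ n * z ^ n.choose 2 := by
  induction n with
  | zero => simp
  | succ n ih =>
    have hc : ∀ m, z ^ m * (x * y) = x * y * z ^ m := fun m => ((hx.mul_right hy).pow_left m).eq
    have hn : z ^ n * (x * y ^ (n + 1)) = x * y ^ (n + 1) * z ^ n :=
      ((hx.pow_left n).mul_right ((hy.pow_left n).pow_right (n + 1))).eq
    calc (x * y) ^ (n + 1) = x ^ n * y ^ n * (z ^ n.choose 2 * (x * y)) := by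
          rw [pow_succ, ih, mul_assoc]
      _ = x ^ n * (y ^ n * x) * y * z ^ n.choose 2 := by rw [hc]; group
      _ = x ^ n * (z ^ n * (x * y ^ (n + 1))) * z ^ n.choose 2 := by
          rw [pow_mul_eq_of_mul_comm_eq hy h, pow_succ]; group
      _ = x ^ (n + 1) * y ^ (n + 1) * z ^ (n + 1).choose 2 := by
          rw [hn, Nat.choose_succ_succ', Nat.choose_one_right, pow_add, pow_succ x]; group

theorem mul_pow_eq_of_commutator {x y : G} {n : ℕ} (hx : Commute ⁅y, x⁆ x)
    (hy : Commute ⁅y, x⁆ y) (h : ⁅y, x⁆ ^ n.choose 2 = 1) : (x * y) ^ n = x ^ n * y ^ n := by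
  rw [mul_pow_eq_of_mul_comm_eq hx hy (by simp [commutatorElement_def]), h, mul_one]

theorem commute_pow_of_commutator {g x : G} {n : ℕ} (hc : Commute ⁅x, ⁅g, x⁆⁆ ⁅g, x⁆)
    (hx : Commute ⁅x, ⁅g, x⁆⁆ x) (h : ⁅x, ⁅g, x⁆⁆ ^ n.choose 2 = 1) (hn : ⁅g, x⁆ ^ n = 1) :
    Commute g (x ^ n) := by
  have : g * x ^ n * g⁻¹ = x ^ n := by
    rw [← conj_pow, show g * x * g⁻¹ = ⁅g, x⁆ * x by simp [commutatorElement_def],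
      mul_pow_eq_of_commutator hc hx h, hn, one_mul]
  exact mul_inv_eq_iff_eq_mul.mp this

theorem QuotientGroup.commute_mk_iff {R : Subgroup G} [R.Normal] {a b : G} :
    Commute (a : G ⧸ R) (b : G ⧸ R) ↔ ⁅a, b⁆ ∈ R := by
  rw [← commutatorElement_eq_one_iff_commute, ← QuotientGroup.eq_one_iff]
  rfl

theorem Subgroup.commutator_closure_top_le {S : Set G} {R : Subgroup G} [R.Normal]
    (h : ∀ x ∈ S, ∀ g : G, Commute (g : G ⧸ R) (x : G ⧸ R)) :
    ⁅closure S, (⊤ : Subgroup G)⁆ ≤ R := by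
  have hle : closure S ≤ (center (G ⧸ R)).comap (QuotientGroup.mk' R) := by
    refine (closure_le _).mpr fun x hx => mem_center_iff.mpr fun q => ?_
    induction q using QuotientGroup.induction_on with | _ g => exact h x hx g
  refine commutator_le.mpr fun x hx g _ => QuotientGroup.commute_mk_iff.mp ?_
  exact (mem_center_iff.mp (hle hx) g).symm

theorem Subgroup.le_of_le_sup_commutator [Group.IsNilpotent G] {C L : Subgroup G} [L.Normal]
    (h : C ≤ L ⊔ ⁅C, ⊤⁆) : C ≤ L := by
  obtain ⟨n, hn⟩ := nilpotent_iff_lowerCentralSeries.mp ‹Group.IsNilpotent G›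
  suffices ∀ n, C ≤ L ⊔ (⊤ : Subgroup G).lowerCentralSeries n by
    simpa only [hn, sup_bot_eq] using this n
  intro n
  induction n with
  | zero => simp
  | succ n ih =>
    refine h.trans (sup_le le_sup_left (commutator_le.mpr fun x hx g _ => ?_))
    obtain ⟨l, hl, k, hk, rfl⟩ := mem_sup_of_normal_left.mp (ih hx)
    rw [show ⁅l * k, g⁆ = l * ⁅k, g⁆ * l⁻¹ * ⁅l, g⁆ by simp [commutatorElement_def, mul_assoc]]
    refine mul_mem (Normal.conj_mem inferInstance _ (mem_sup_right ?_) _)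
      (mem_sup_left (commutator_le_left L ⊤ (commutator_mem_commutator hl (mem_top g))))
    exact commutator_mem_commutator hk (mem_top g)

end GroupIdentities

namespace Subgroup

open scoped commutatorElement

variable {G : Type*} [Group G]

/-- The subgroup generated by the `n`-th powers of elements of `N`. -/
def powers (n : ℕ) (N : Subgroup G) : Subgroup G :=
  closure ((· ^ n) '' (N : Set G))

theorem pow_mem_powers {n : ℕ} {N : Subgroup G} {x : G} (hx : x ∈ N) : x ^ n ∈ powers n N :=
  subset_closure ⟨x, hx, rfl⟩

theorem powers_le (n : ℕ) (N : Subgroup G) : powers n N ≤ N :=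
  (closure_le _).mpr (by rintro _ ⟨x, hx, rfl⟩; exact pow_mem hx n)

theorem powers_top (n : ℕ) : powers n (⊤ : Subgroup G) = powerSubgroup G n := by
  simp [powers, powerSubgroup, Set.range]

instance powers_normal (n : ℕ) (N : Subgroup G) [hN : N.Normal] : (powers n N).Normal := by
  refine ⟨fun a ha g => ?_⟩
  suffices powers n N ≤ (powers n N).comap (MulAut.conj g).toMonoidHom from this ha
  refine (closure_le _).mpr ?_
  rintro _ ⟨x, hx, rfl⟩
  have := pow_mem_powers (n := n) (hN.conj_mem x hx g)
  simpa [conj_pow] using this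

/-- `N` is powerfully embedded in `G`. For `p = 2` the fourth powers are replaced by squares of
squares. -/
structure IsPowerfullyEmbedded (p : ℕ) (N : Subgroup G) : Prop where
  commutator_le : ⁅N, (⊤ : Subgroup G)⁆ ≤ powers p N
  commutator_le_of_eq_two : p = 2 → ⁅N, (⊤ : Subgroup G)⁆ ≤ powers p (powers p N)

theorem isPowerfullyEmbedded_top {p : ℕ} (h : IsPowerful p G) :
    IsPowerfullyEmbedded p (⊤ : Subgroup G) := by
  unfold IsPowerful at h
  split_ifs at h with hp
  · subst hp
    have h4 : powerSubgroup G 4 ≤ powers 2 (powers 2 ⊤) := by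
      refine (closure_le _).mpr ?_
      rintro _ ⟨x, rfl⟩
      rw [show 4 = 2 * 2 from rfl, pow_mul]
      exact pow_mem_powers (pow_mem_powers (mem_top x))
    exact ⟨(h.trans h4).trans (powers_le _ _), fun _ => h.trans h4⟩
  · exact ⟨by rwa [powers_top], fun h2 => absurd h2 hp⟩

theorem pow_choose_two_mem {p : ℕ} (hp : p.Prime) (hp2 : p ≠ 2) {K : Subgroup G} {z : G}
    (hz : z ^ p ∈ K) : z ^ p.choose 2 ∈ K := by
  obtain ⟨k, hk⟩ := hp.dvd_choose_self two_ne_zero (hp.two_le.lt_of_ne' hp2)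
  rw [hk, pow_mul]
  exact pow_mem hz k

theorem IsPowerfullyEmbedded.powers [Group.IsNilpotent G] {p : ℕ} (hp : p.Prime)
    {N : Subgroup G} [N.Normal] (h : IsPowerfullyEmbedded p N) :
    IsPowerfullyEmbedded p (powers p N) := by
  set M := Subgroup.powers p N
  set L := Subgroup.powers p M
  by_cases hp2 : p = 2
  · suffices key : ⁅M, (⊤ : Subgroup G)⁆ ≤ Subgroup.powers p L from
      ⟨key.trans (powers_le _ _), fun _ => key⟩
    refine le_of_le_sup_commutator ?_
    set R := Subgroup.powers p L ⊔ ⁅⁅M, (⊤ : Subgroup G)⁆, ⊤⁆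
    have hc : ∀ c ∈ ⁅M, (⊤ : Subgroup G)⁆, ∀ g : G, Commute (c : G ⧸ R) (g : G ⧸ R) :=
      fun c hc g => QuotientGroup.commute_mk_iff.mpr
        (mem_sup_right (commutator_mem_commutator hc (mem_top g)))
    have hmemL : ∀ x ∈ N, ∀ g : G, ⁅g, x⁆ ∈ L := fun x hx g => by
      rw [← commutatorElement_inv]
      exact inv_mem (h.commutator_le_of_eq_two hp2 (commutator_mem_commutator hx (mem_top g)))
    have hpow : ∀ x ∈ N, ∀ g : G, ((⁅g, x⁆ : G) : G ⧸ R) ^ p = 1 := fun x hx g =>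
      (QuotientGroup.eq_one_iff (⁅g, x⁆ ^ p)).mpr (mem_sup_left (pow_mem_powers (hmemL x hx g)))
    have hcen : ⁅L, (⊤ : Subgroup G)⁆ ≤ R := by
      refine commutator_closure_top_le ?_
      rintro _ ⟨y, hy, rfl⟩ g
      have h1 : ∀ k : G, Commute ((⁅g, y⁆ : G) : G ⧸ R) (k : G ⧸ R) := fun k => by
        refine hc ⁅g, y⁆ ?_ k
        rw [← commutatorElement_inv]
        exact inv_mem (commutator_mem_commutator hy (mem_top g))
      have h2 : ⁅(y : G ⧸ R), ⁅(g : G ⧸ R), (y : G ⧸ R)⁆⁆ = 1 :=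
        commutatorElement_eq_one_iff_commute.mpr (h1 y).symm
      refine commute_pow_of_commutator (g := (g : G ⧸ R)) (x := (y : G ⧸ R)) ?_ ?_ ?_
        (hpow y (powers_le _ _ hy) g) <;> simp [h2]
    refine commutator_closure_top_le ?_
    rintro _ ⟨x, hx, rfl⟩ g
    have h2 : ⁅(x : G ⧸ R), ⁅(g : G ⧸ R), (x : G ⧸ R)⁆⁆ = 1 :=
      commutatorElement_eq_one_iff_commute.mpr (QuotientGroup.commute_mk_iff.mpr
        (hcen (commutator_mem_commutator (hmemL x hx g) (mem_top x)))).symm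
    refine commute_pow_of_commutator (g := (g : G ⧸ R)) (x := (x : G ⧸ R)) ?_ ?_ ?_
      (hpow x hx g) <;> simp [h2]
  · refine ⟨?_, fun h2 => absurd h2 hp2⟩
    refine le_of_le_sup_commutator ?_
    set R := L ⊔ ⁅⁅M, (⊤ : Subgroup G)⁆, ⊤⁆
    refine commutator_closure_top_le ?_
    rintro _ ⟨x, hx, rfl⟩ g
    have hc : ⁅g, x⁆ ∈ M := by
      rw [← commutatorElement_inv]
      exact inv_mem (h.commutator_le (commutator_mem_commutator hx (mem_top g)))
    have hz : ⁅x, ⁅g, x⁆⁆ ∈ ⁅M, (⊤ : Subgroup G)⁆ := by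
      rw [← commutatorElement_inv]
      exact inv_mem (commutator_mem_commutator hc (mem_top x))
    have hzc : ∀ k : G, Commute ((⁅x, ⁅g, x⁆⁆ : G) : G ⧸ R) (k : G ⧸ R) := fun k =>
      QuotientGroup.commute_mk_iff.mpr
        (mem_sup_right (commutator_mem_commutator hz (mem_top k)))
    refine commute_pow_of_commutator (g := (g : G ⧸ R)) (x := (x : G ⧸ R))
      (hzc ⁅g, x⁆) (hzc x) ?_ ?_
    · exact (QuotientGroup.eq_one_iff (⁅x, ⁅g, x⁆⁆ ^ p.choose 2)).mpr
        (pow_choose_two_mem hp hp2 (mem_sup_left (pow_mem_powers (commutator_le_left _ _ hz))))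
    · exact (QuotientGroup.eq_one_iff (⁅g, x⁆ ^ p)).mpr (mem_sup_left (pow_mem_powers hc))

theorem IsPowerfullyEmbedded.mk_mul_pow [Group.IsNilpotent G] {p : ℕ} (hp : p.Prime)
    {N : Subgroup G} [N.Normal] (h : IsPowerfullyEmbedded p N) {x y : G} (hx : x ∈ N) :
    (((x * y) ^ p : G) : G ⧸ Subgroup.powers p (Subgroup.powers p N)) =
      ((x ^ p * y ^ p : G) : G ⧸ Subgroup.powers p (Subgroup.powers p N)) := by
  set R := Subgroup.powers p (Subgroup.powers p N)
  have hc : ⁅y, x⁆ ∈ ⁅N, (⊤ : Subgroup G)⁆ := by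
    rw [← commutatorElement_inv]
    exact inv_mem (commutator_mem_commutator hx (mem_top y))
  have hcen : ∀ k : G, Commute ((⁅y, x⁆ : G) : G ⧸ R) (k : G ⧸ R) := fun k =>
    QuotientGroup.commute_mk_iff.mpr ((h.powers hp).commutator_le
      (commutator_mem_commutator (h.commutator_le hc) (mem_top k)))
  refine mul_pow_eq_of_commutator (x := (x : G ⧸ R)) (y := (y : G ⧸ R)) (hcen x) (hcen y)
    ((QuotientGroup.eq_one_iff (⁅y, x⁆ ^ p.choose 2)).mpr ?_)
  by_cases hp2 : p = 2
  · exact pow_mem (h.commutator_le_of_eq_two hp2 hc) _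
  · exact pow_choose_two_mem hp hp2 (pow_mem_powers (h.commutator_le hc))

theorem powers_lt {p : ℕ} (hp : p.Prime) [Finite G] (hG : IsPGroup p G) {N : Subgroup G}
    (hN : N ≠ ⊥) : powers p N < N := by
  have := Fact.mk hp
  obtain ⟨n, hn⟩ := IsPGroup.iff_card.mp (hG.to_subgroup N)
  obtain ⟨n, rfl⟩ : ∃ m, n = m + 1 := Nat.exists_eq_succ_of_ne_zero fun h0 =>
    hN (N.eq_bot_of_card_eq (by simpa [h0] using hn))
  obtain ⟨K, hK⟩ := Sylow.exists_subgroup_card_pow_prime (G := N) p (n := n)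
    (by rw [hn]; exact pow_dvd_pow p n.le_succ)
  have hidx : K.index = p := by
    have := K.card_mul_index
    rw [hK, hn, pow_succ] at this
    exact Nat.eq_of_mul_eq_mul_left (pow_pos hp.pos n) this
  have : K.Normal := normal_of_index_eq_minFac_card (by
    rw [hidx, hn, Nat.Prime.pow_minFac hp n.succ_ne_zero])
  refine (powers_le p N).lt_of_ne fun heq => ?_
  have hle : powers p N ≤ K.map N.subtype := by
    refine (closure_le _).mpr ?_
    rintro _ ⟨x, hx, rfl⟩
    exact ⟨⟨x, hx⟩ ^ p, hidx ▸ K.pow_index_mem ⟨x, hx⟩, rfl⟩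
  rw [heq] at hle
  have htop : K = ⊤ := eq_top_iff.mpr fun x _ => by
    obtain ⟨y, hy, hyx⟩ := hle x.2
    rwa [← Subtype.ext hyx]
  rw [htop, index_top] at hidx
  exact hp.one_lt.ne hidx

end Subgroup

section LinearAlgebra

variable {K ι V V' : Type*} [DivisionRing K] [AddCommGroup V] [Module K V] [AddCommGroup V']
  [Module K V']

theorem LinearIndepOn.finrank_span_image {v : ι → V} {s : Set ι} (h : LinearIndepOn K v s)
    (hs : s.Finite) : Module.finrank K (Submodule.span K (v '' s)) = s.ncard := by
  have := hs.fintype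
  have := finrank_span_eq_card h.linearIndependent
  rwa [← Nat.card_eq_fintype_card, Nat.card_coe_set_eq, ← Set.image_eq_range] at this

theorem LinearMap.finrank_add_finrank_le_of_surjective [FiniteDimensional K V] {f : V →ₗ[K] V'}
    (hf : Function.Surjective f) (W : Submodule K V) :
    Module.finrank K W + Module.finrank K V' ≤
      Module.finrank K V + Module.finrank K (W.map f) := by
  have h₁ := f.finrank_range_add_finrank_ker
  have h₂ := (f.domRestrict W).finrank_range_add_finrank_ker
  rw [LinearMap.range_domRestrict] at h₂
  rw [LinearMap.range_eq_top.mpr hf, finrank_top] at h₁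
  have h₃ : Module.finrank K (f.domRestrict W).ker ≤ Module.finrank K f.ker := by
    rw [LinearMap.ker_domRestrict, ← Submodule.finrank_map_subtype_eq]
    refine Submodule.finrank_mono ?_
    rintro _ ⟨x, hx, rfl⟩
    exact hx
  omega

end LinearAlgebra

namespace Subgroup

variable {G : Type*} [Group G]

/-- `φ` restricts to a surjective homomorphism from `N` to the additive group `V` with
kernel `M`. -/
structure IsLayerMap {V : Type*} [AddCommGroup V] (φ : G → V) (N M : Subgroup G) : Prop where
  map_mul : ∀ x ∈ N, ∀ y ∈ N, φ (x * y) = φ x + φ y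
  eq_zero_iff : ∀ x ∈ N, φ x = 0 ↔ x ∈ M
  surj : ∀ v, ∃ x ∈ N, φ x = v

namespace IsLayerMap

variable {V : Type*} [AddCommGroup V] {φ : G → V} {N M : Subgroup G}

theorem map_one (h : IsLayerMap φ N M) : φ 1 = 0 :=
  (h.eq_zero_iff 1 (one_mem N)).mpr (one_mem M)

theorem finite [Finite G] (h : IsLayerMap φ N M) : Finite V :=
  Finite.of_surjective φ fun v => (h.surj v).imp fun _ => And.right

theorem map_pow (h : IsLayerMap φ N M) {x : G} (hx : x ∈ N) (n : ℕ) : φ (x ^ n) = n • φ x := by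
  induction n with
  | zero => simp [h.map_one]
  | succ n ih => rw [pow_succ, h.map_mul _ (pow_mem hx n) _ hx, ih, succ_nsmul]

theorem inv_mul_mem (h : IsLayerMap φ N M) {x y : G} (hx : x ∈ N) (hy : y ∈ N)
    (hxy : φ x = φ y) : x⁻¹ * y ∈ M := by
  have hxy' : x⁻¹ * y ∈ N := mul_mem (inv_mem hx) hy
  have := h.map_mul x hx _ hxy'
  rw [mul_inv_cancel_left, hxy, left_eq_add] at this
  exact (h.eq_zero_iff _ hxy').mp this

theorem exists_mem_closure {p : ℕ} [NeZero p] [Module (ZMod p) V] (h : IsLayerMap φ N M)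
    {B : Set G} (hB : B ⊆ N) {v : V} (hv : v ∈ Submodule.span (ZMod p) (φ '' B)) :
    ∃ b ∈ closure B, φ b = v := by
  have hBN : closure B ≤ N := (closure_le _).mpr hB
  induction hv using Submodule.span_induction with
  | mem x hx =>
    obtain ⟨b, hb, rfl⟩ := hx
    exact ⟨b, subset_closure hb, rfl⟩
  | zero => exact ⟨1, one_mem _, h.map_one⟩
  | add x y _ _ hx hy =>
    obtain ⟨a, ha, rfl⟩ := hx
    obtain ⟨b, hb, rfl⟩ := hy
    exact ⟨a * b, mul_mem ha hb, h.map_mul a (hBN ha) b (hBN hb)⟩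
  | smul c x _ hx =>
    obtain ⟨a, ha, rfl⟩ := hx
    refine ⟨a ^ c.val, pow_mem ha _, ?_⟩
    rw [h.map_pow (hBN ha), ← Nat.cast_smul_eq_nsmul (ZMod p), ZMod.natCast_zmod_val]

end IsLayerMap

theorem exists_isLayerMap.{u} {G : Type u} [Group G] {p : ℕ} {N M : Subgroup G} [M.Normal]
    (hpow : ∀ x ∈ N, x ^ p ∈ M) (hcomm : ⁅N, N⁆ ≤ M) :
    ∃ (V : Type u) (_ : AddCommGroup V) (_ : Module (ZMod p) V) (φ : G → V),
      IsLayerMap φ N M := by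
  classical
  have hc : ∀ a b : N ⧸ M.subgroupOf N, a * b = b * a := fun a b => by
    induction a using QuotientGroup.induction_on with | _ a
    induction b using QuotientGroup.induction_on with | _ b
    exact QuotientGroup.commute_mk_iff.mpr (hcomm (commutator_mem_commutator a.2 b.2))
  let : CommGroup (N ⧸ M.subgroupOf N) := { mul_comm := hc }
  let : Module (ZMod p) (Additive (N ⧸ M.subgroupOf N)) := AddCommGroup.zmodModule fun x => by
    induction x using Additive.rec with | _ x
    induction x using QuotientGroup.induction_on with | _ x
    exact congrArg Additive.ofMul ((QuotientGroup.eq_one_iff (x ^ p)).mpr (hpow x x.2))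
  refine ⟨Additive (N ⧸ M.subgroupOf N), inferInstance, inferInstance,
    fun x => if hx : x ∈ N then Additive.ofMul ((⟨x, hx⟩ : N) : N ⧸ M.subgroupOf N) else 0,
    fun x hx y hy => ?_, fun x hx => ?_, fun v => ?_⟩
  · simp only [hx, hy, mul_mem hx hy, dif_pos]
    rfl
  · simp only [hx, dif_pos]
    exact (QuotientGroup.eq_one_iff (⟨x, hx⟩ : N)).trans mem_subgroupOf
  · induction v using Additive.rec with | _ v
    induction v using QuotientGroup.induction_on with | _ v
    exact ⟨v, v.2, by simp⟩

variable {p : ℕ}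

theorem IsPowerfullyEmbedded.exists_isLayerMap.{u} {G : Type u} [Group G]
    {N : Subgroup G} [N.Normal]
    (h : IsPowerfullyEmbedded p N) :
    ∃ (V : Type u) (_ : AddCommGroup V) (_ : Module (ZMod p) V) (φ : G → V),
      IsLayerMap φ N (Subgroup.powers p N) :=
  Subgroup.exists_isLayerMap (fun _ => pow_mem_powers)
    ((commutator_mono le_rfl le_top).trans h.commutator_le)

theorem IsPowerfullyEmbedded.exists_linearMap [Group.IsNilpotent G] (hp : p.Prime)
    {N : Subgroup G} [N.Normal] (h : IsPowerfullyEmbedded p N)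
    {V V' : Type*} [AddCommGroup V] [Module (ZMod p) V] [AddCommGroup V'] [Module (ZMod p) V']
    {φ : G → V} {φ' : G → V'} (hφ : IsLayerMap φ N (Subgroup.powers p N))
    (hφ' : IsLayerMap φ' (Subgroup.powers p N) (Subgroup.powers p (Subgroup.powers p N))) :
    ∃ f : V →ₗ[ZMod p] V', Function.Surjective f ∧ ∀ x ∈ N, f (φ x) = φ' (x ^ p) := by
  have hmul : ∀ x ∈ N, ∀ y ∈ N, φ' ((x * y) ^ p) = φ' (x ^ p) + φ' (y ^ p) := by
    intro x hx y hy
    have hxy := QuotientGroup.eq.mp (h.mk_mul_pow hp hx (y := y)).symm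
    have hp' := mul_mem (pow_mem_powers (n := p) hx) (pow_mem_powers (n := p) hy)
    rw [← hφ'.map_mul _ (pow_mem_powers hx) _ (pow_mem_powers hy),
      ← mul_inv_cancel_left (x ^ p * y ^ p) ((x * y) ^ p),
      hφ'.map_mul _ hp' _ (powers_le _ _ hxy), (hφ'.eq_zero_iff _ (powers_le _ _ hxy)).mpr hxy,
      add_zero]
  choose s hsN hs using hφ.surj
  have hcongr : ∀ x ∈ N, ∀ y ∈ N, φ x = φ y → φ' (x ^ p) = φ' (y ^ p) := by
    intro x hx y hy hxy
    have hz := hφ.inv_mul_mem hx hy hxy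
    rw [← mul_inv_cancel_left x y, hmul x hx _ (powers_le _ _ hz),
      (hφ'.eq_zero_iff ((x⁻¹ * y) ^ p) (pow_mem hz p)).mpr (pow_mem_powers hz), add_zero]
  let f : V →+ V' := AddMonoidHom.mk' (fun v => φ' (s v ^ p)) fun v w => by
    rw [← hmul _ (hsN v) _ (hsN w)]
    exact hcongr _ (hsN _) _ (mul_mem (hsN v) (hsN w)) (by
      rw [hs, hφ.map_mul _ (hsN v) _ (hsN w), hs, hs])
  have hf : ∀ x ∈ N, f (φ x) = φ' (x ^ p) := fun x hx => hcongr _ (hsN _) _ hx (hs _)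
  refine ⟨f.toZModLinearMap p, fun w => ?_, hf⟩
  obtain ⟨m, hm, rfl⟩ := hφ'.surj w
  change φ' m ∈ f.range
  induction hm using closure_induction with
  | mem x hx =>
    obtain ⟨y, hy, rfl⟩ := hx
    exact ⟨φ y, hf y hy⟩
  | one => simp [hφ'.map_one]
  | mul x y hx hy ihx ihy => rw [hφ'.map_mul x hx y hy]; exact add_mem ihx ihy
  | inv x hx ihx =>
    have := hφ'.map_mul x hx _ (inv_mem hx)
    rw [mul_inv_cancel, hφ'.map_one] at this
    rw [eq_neg_of_add_eq_zero_right this.symm]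
    exact neg_mem ihx

theorem IsPowerfullyEmbedded.exists_closure_eq.{u} {G : Type u} [Group G] [Finite G] (hp : p.Prime)
    (hG : IsPGroup p G) (N : Subgroup G) [N.Normal] (hN : IsPowerfullyEmbedded p N)
    {V : Type u} [AddCommGroup V] [Module (ZMod p) V] {φ : G → V}
    (hφ : IsLayerMap φ N (Subgroup.powers p N)) {H : Subgroup G} (hH : H ≤ N) {S : Set G}
    (hSH : S ⊆ H) (hS : LinearIndepOn (ZMod p) φ S) :
    ∃ T : Set G, S ⊆ T ∧ closure T = H ∧ T.ncard ≤ Module.finrank (ZMod p) V := by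
  have := Fact.mk hp
  have := hG.isNilpotent
  induction hn : Nat.card N using Nat.strong_induction_on generalizing N V H S with | _ n ih
  subst hn
  rcases eq_or_ne N ⊥ with rfl | hbot
  · obtain rfl := le_bot_iff.mp hH
    obtain rfl : S = ∅ := Set.eq_empty_of_forall_notMem fun x hx =>
      hS.zero_notMem_image ⟨x, hx, by rw [mem_bot.mp (hSH hx), hφ.map_one]⟩
    exact ⟨∅, subset_rfl, by simp, by simp⟩
  obtain ⟨V', _, _, φ', hφ'⟩ := (hN.powers hp).exists_isLayerMap
  obtain ⟨f, hfsurj, hf⟩ := hN.exists_linearMap hp hφ hφ'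
  have := hφ.finite
  obtain ⟨B, hBH, hSB, hBspan, hB⟩ := exists_linearIndepOn_extension hS hSH
  obtain ⟨B', hBB', -, hBspan', hB'⟩ := exists_linearIndepOn_extension
    (linearIndepOn_empty (ZMod p) fun x => φ' (x ^ p)) B.empty_subset
  have hinj : Set.InjOn (· ^ p) B' := fun x hx y hy hxy => hB'.injOn hx hy (congrArg φ' hxy)
  have hrank : B.ncard + Module.finrank (ZMod p) V' ≤ Module.finrank (ZMod p) V + B'.ncard := by
    rw [← hB.finrank_span_image B.toFinite, ← hB'.finrank_span_image B'.toFinite]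
    refine (LinearMap.finrank_add_finrank_le_of_surjective hfsurj _).trans
      (Nat.add_le_add_left ?_ _)
    have := hφ'.finite
    refine Submodule.finrank_mono ?_
    rw [Submodule.map_span, Submodule.span_le]
    rintro _ ⟨_, ⟨b, hb, rfl⟩, rfl⟩
    rw [hf b (hH (hBH hb))]
    exact hBspan' ⟨b, hb, rfl⟩
  have hpowB' : (· ^ p) '' B' ⊆ ((H ⊓ Subgroup.powers p N : Subgroup G) : Set G) := by
    rintro _ ⟨b, hb, rfl⟩
    exact ⟨pow_mem (hBH (hBB' hb)) p, pow_mem_powers (hH (hBH (hBB' hb)))⟩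
  obtain ⟨T, hBT, hTK, hTcard⟩ := ih _ (Set.ncard_lt_ncard (powers_lt hp hG hbot))
    (Subgroup.powers p N) (hN.powers hp) hφ' inf_le_right hpowB'
    (LinearIndepOn.image_of_comp (· ^ p) φ' hB') rfl
  refine ⟨B ∪ (T \ (· ^ p) '' B'), hSB.trans Set.subset_union_left, le_antisymm ?_ ?_, ?_⟩
  · refine (closure_le _).mpr (Set.union_subset hBH (Set.sdiff_subset.trans ?_))
    exact (closure_le _).mp (hTK.le.trans inf_le_left)
  · set C := closure (B ∪ (T \ (· ^ p) '' B'))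
    have hBC : closure B ≤ C := closure_mono Set.subset_union_left
    have hKC : H ⊓ Subgroup.powers p N ≤ C := by
      rw [← hTK, closure_le]
      intro t ht
      by_cases htB : t ∈ (· ^ p) '' B'
      · obtain ⟨b, hb, rfl⟩ := htB
        exact pow_mem (hBC (subset_closure (hBB' hb))) p
      · exact subset_closure (Or.inr ⟨ht, htB⟩)
    intro h hh
    obtain ⟨b, hb, hbh⟩ := hφ.exists_mem_closure (hBH.trans hH) (hBspan ⟨h, hh, rfl⟩)
    have hbH : b ∈ H := (closure_le H).mpr hBH hb
    rw [← mul_inv_cancel_left b h]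
    exact mul_mem (hBC hb) (hKC (mem_inf.mpr
      ⟨mul_mem (inv_mem hbH) hh, hφ.inv_mul_mem (hH hbH) (hH hh) hbh⟩))
  · have h₁ := Set.ncard_union_le B (T \ (· ^ p) '' B')
    have h₂ := Set.ncard_sdiff_add_ncard_of_subset hBT
    rw [hinj.ncard_image] at h₂
    omega

end Subgroup

/-- If `G` is a finite powerful `p`-group and `H ≤ G` has minimal number of
generators `r`, then `G` contains `r` elements whose images in `G / G^p` are
linearly independent over `𝔽_p`, i.e. the images generate a subgroup of order `p ^ r`. -/
theorem exists_linearly_independent_of_subgroup_rank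
    (p : ℕ) (hp : p.Prime) (G : Type) [Group G] [Finite G]
    (hG : IsPGroup p G) (hpowerful : IsPowerful p G)
    (H : Subgroup G) (r : ℕ) (hr : Group.rank H = r) :
    ∃ a : Fin r → G,
      Nat.card (Subgroup.closure
        (Set.range fun i => ((a i : G) : G ⧸ powerSubgroup G p))) = p ^ r := by
  have := Fact.mk hp
  have hN := Subgroup.isPowerfullyEmbedded_top hpowerful
  obtain ⟨V, _, _, φ, hφ⟩ := hN.exists_isLayerMap
  have := hφ.finite
  obtain ⟨T, -, hT, hTcard⟩ := hN.exists_closure_eq hp hG ⊤ hφ (le_top : H ≤ ⊤)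
    (Set.empty_subset _) (linearIndepOn_empty (ZMod p) φ)
  have hrank : r ≤ Module.finrank (ZMod p) V := by
    subst hT hr
    exact (Subgroup.rank_closure_finite_le_nat_card T).trans hTcard
  rw [Subgroup.powers_top] at hφ
  choose s _ hs using hφ.surj
  let b := Module.finBasis (ZMod p) V
  let v : Fin r → V := fun i => b (Fin.castLE hrank i)
  have hv : LinearIndependent (ZMod p) v :=
    b.linearIndependent.comp _ (Fin.castLE_injective hrank)
  refine ⟨fun i => s (v i), ?_⟩
  let f : G →* Multiplicative V :=
    { toFun := fun x => Multiplicative.ofAdd (φ x)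
      map_one' := congrArg Multiplicative.ofAdd hφ.map_one
      map_mul' := fun x y => congrArg Multiplicative.ofAdd
        (hφ.map_mul x (Subgroup.mem_top x) y (Subgroup.mem_top y)) }
  have hker : f.ker = powerSubgroup G p :=
    Subgroup.ext fun x => hφ.eq_zero_iff x (Subgroup.mem_top x)
  let e : G ⧸ powerSubgroup G p →* Multiplicative V :=
    QuotientGroup.lift (powerSubgroup G p) f hker.ge
  have he : Function.Injective e :=
    (QuotientGroup.injective_lift_iff _ f hker.ge).mpr hker.symm
  have hspan : Nat.card (Submodule.span (ZMod p) (Set.range v)) = p ^ r := by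
    rw [Module.natCard_eq_pow_finrank (K := ZMod p), finrank_span_eq_card hv, Nat.card_zmod,
      Fintype.card_fin]
  rw [← hspan, ← Subgroup.card_map_of_injective he, MonoidHom.map_closure]
  suffices Subgroup.closure (e '' Set.range fun i => ((s (v i) : G) : G ⧸ powerSubgroup G p)) =
      AddSubgroup.toSubgroup (Submodule.span (ZMod p) (Set.range v)).toAddSubgroup by
    rw [this]
    rfl
  have hev : ∀ i, e (s (v i) : G) = Multiplicative.ofAdd (v i) := fun i =>
    congrArg Multiplicative.ofAdd (hs (v i))
  rw [← Set.range_comp, show e ∘ (fun i => ((s (v i) : G) : G ⧸ powerSubgroup G p)) =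
    fun i => Multiplicative.ofAdd (v i) from funext hev]
  refine le_antisymm ((Subgroup.closure_le _).mpr ?_) ?_
  · rintro _ ⟨i, rfl⟩
    change v i ∈ Submodule.span (ZMod p) (Set.range v)
    exact Submodule.subset_span ⟨i, rfl⟩
  · set K := Subgroup.closure (Set.range fun i => Multiplicative.ofAdd (v i))
    have : Submodule.span (ZMod p) (Set.range v) ≤
        AddSubgroup.toZModSubmodule p (AddSubgroup.toSubgroup.symm K) := by
      refine Submodule.span_le.mpr ?_
      rintro _ ⟨i, rfl⟩
      change Multiplicative.ofAdd (v i) ∈ K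
      exact Subgroup.subset_closure ⟨i, rfl⟩
    exact this
end
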